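/- arXiv:0910.1861 — 4 statements merged into one kernel-verified Lean document; each statement's English description precedes it below -/
import Mathlib

section
/- Let T be a finitary pretriangulated category over finite hom-sets. Let DH(T) be the ℚ-vector space of finitely supported ℚ-valued functions on the set of isomorphism classes of objects of T, with basis the characteristic functions χ_{[x]} of isomorphism classes [x]. Then the bilinear product on DH(T) determined by χ_{[x]} · χ_{[y]} = ∑_{[z]} g^z_{x,y} χ_{[z]} is well defined (the derived Hall number g^z_{x,y} depends only on the isomorphism classes of x, y and z, and for fixed x and y it is nonzero for only finitely many isomorphism classes [z]), and it makes DH(T) a unital associative ℚ-algebra whose unit is χ_{[0]}, where 0 is the zero object of T. -/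
open CategoryTheory CategoryTheory.Limits CategoryTheory.Pretriangulated

namespace DerivedHall

variable (T : Type*) [Category T] [HasZeroObject T] [HasShift T ℤ]
  [Preadditive T] [∀ n : ℤ, (CategoryTheory.shiftFunctor T n).Additive] [Pretriangulated T]

/-- The vanishing part of the finitary condition: for all objects `x, y`, the group
`Ext^{-i}(x,y) = Hom(x, y⟦-i⟧)` vanishes for all sufficiently large `i > 0`.
(The finiteness of each `Ext^n(x,y)` is the hypothesis `∀ x y : T, Finite (x ⟶ y)`.) -/
def Finitary : Prop :=
  ∀ x y : T, ∃ N : ℕ, ∀ i : ℕ, N ≤ i → ∀ f : x ⟶ y⟦(-(i : ℤ))⟧, f = 0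

/-- `[x,z]_y`: the set of morphisms `f : x ⟶ z` admitting a distinguished triangle
`x ⟶ z ⟶ y' ⟶ x⟦1⟧` whose third object `y'` is isomorphic to `y`. -/
def hallSet (x z y : T) : Set (x ⟶ z) :=
  {f | ∃ (y' : T) (g : z ⟶ y') (h : y' ⟶ x⟦(1 : ℤ)⟧),
      (Triangle.mk f g h ∈ distTriang T) ∧ Nonempty (y' ≅ y)}

/-- The alternating product `∏_{i>0} |Ext^{-i}(x,y)|^{(-1)^i}`, where
`Ext^{-i}(x,y) = Hom(x, y⟦-i⟧)`.  All but finitely many factors are `1` in the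
finitary situation, so the `finprod` agrees with the finite product. -/
noncomputable def extAltProd (x y : T) : ℚ :=
  ∏ᶠ i : ℕ, ((Nat.card (x ⟶ y⟦(-(i : ℤ) - 1)⟧) : ℚ) ^ ((-1 : ℤ) ^ (i + 1)))

/-- The derived Hall number
`g^z_{x,y} = (|[x,z]_y| ⬝ ∏_{i>0} |Ext^{-i}(x,z)|^{(-1)^i}) /
(|Aut x| ⬝ ∏_{i>0} |Ext^{-i}(x,x)|^{(-1)^i})`. -/
noncomputable def hallNumber (x y z : T) : ℚ :=
  ((Nat.card (hallSet T x z y) : ℚ) * extAltProd T x z) /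
    ((Nat.card (Aut x) : ℚ) * extAltProd T x x)

/-- Isomorphism classes of objects of `T`. -/
abbrev IsoClass := Quotient (isIsomorphicSetoid T)

/-- The isomorphism class of an object. -/
def cls (x : T) : IsoClass T := Quotient.mk (isIsomorphicSetoid T) x

/-- The derived Hall number as a function of isomorphism classes, defined via chosen
representatives. -/
noncomputable def hallNumberQ (a b c : IsoClass T) : ℚ :=
  hallNumber T (Quotient.out a) (Quotient.out b) (Quotient.out c)

/-- The underlying vector space of the derived Hall algebra: finitely supported
`ℚ`-valued functions on the set of isomorphism classes of objects of `T`. -/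
abbrev DH := IsoClass T →₀ ℚ

/-- The characteristic function `χ_{[x]}` of the isomorphism class of `x`. -/
noncomputable def chi (x : T) : DH T := Finsupp.single (cls T x) 1

section Counting

/-- The first isomorphism theorem as a cardinality identity. -/
lemma card_eq_card_ker_mul_card_range {A B : Type*} [AddGroup A] [AddGroup B] (φ : A →+ B) :
    Nat.card A = Nat.card {a // φ a = 0} * Nat.card (Set.range φ) := by
  have h := AddSubgroup.card_eq_card_quotient_mul_card_addSubgroup φ.ker
  rw [Nat.card_congr (QuotientAddGroup.quotientKerEquivRange φ).toEquiv, mul_comm] at h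
  exact h

/-- The rank of `φ` splits along a further homomorphism `ψ`. -/
lemma card_range_eq_mul {A B C : Type*} [AddGroup A] [AddGroup B] [AddGroup C]
    (φ : A →+ B) (ψ : B →+ C) :
    Nat.card (Set.range φ) =
      Nat.card {b // b ∈ Set.range φ ∧ ψ b = 0} * Nat.card (Set.range (ψ.comp φ)) := by
  have h := card_eq_card_ker_mul_card_range (ψ.comp φ.range.subtype)
  have e₁ : Nat.card {b : φ.range // (ψ.comp φ.range.subtype) b = 0} =
      Nat.card {b // b ∈ Set.range φ ∧ ψ b = 0} :=
    Nat.card_congr (Equiv.subtypeSubtypeEquivSubtypeInter (fun b => b ∈ φ.range) (fun b => ψ b = 0))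
  have e₂ : Set.range (ψ.comp φ.range.subtype) = Set.range (ψ.comp φ) := by
    ext c
    constructor
    · rintro ⟨⟨_, a, rfl⟩, rfl⟩
      exact ⟨a, rfl⟩
    · rintro ⟨a, rfl⟩
      exact ⟨⟨φ a, a, rfl⟩, rfl⟩
  rw [e₁, e₂] at h
  exact h

/-- The kernel of `φ` is counted by restricting `ψ` to it. -/
lemma card_ker_eq_mul {A B C : Type*} [AddGroup A] [AddGroup B] [AddGroup C]
    (φ : A →+ B) (ψ : A →+ C) :
    Nat.card {a // φ a = 0} =
      Nat.card {a // φ a = 0 ∧ ψ a = 0} * Nat.card {c // ∃ a, φ a = 0 ∧ ψ a = c} := by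
  have h := card_eq_card_ker_mul_card_range (ψ.comp φ.ker.subtype)
  have e₁ : Nat.card {a : φ.ker // (ψ.comp φ.ker.subtype) a = 0} =
      Nat.card {a // φ a = 0 ∧ ψ a = 0} :=
    Nat.card_congr (Equiv.subtypeSubtypeEquivSubtypeInter (fun a => a ∈ φ.ker) (fun a => ψ a = 0))
  have e₂ : Nat.card (Set.range (ψ.comp φ.ker.subtype)) =
      Nat.card {c // ∃ a, φ a = 0 ∧ ψ a = c} :=
    Nat.card_congr (Equiv.subtypeEquivRight fun c =>
      ⟨fun ⟨⟨a, ha⟩, hc⟩ => ⟨a, ha, hc⟩, fun ⟨a, ha, hc⟩ => ⟨⟨a, ha⟩, hc⟩⟩)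
  rw [e₁, e₂] at h
  exact h

/-- Double counting of a relation between two finite sets with constant fibre sizes, restricted
to subsets that correspond to each other under the relation. -/
lemma card_mul_eq_card_mul_of_relation {A B : Type*} [Finite A] [Finite B] {p Y : A → Prop}
    {q Z : B → Prop} {R : A → B → Prop} {k l : ℕ}
    (hl : ∀ a, p a → Nat.card {b // q b ∧ R a b} = l)
    (hk : ∀ b, q b → Nat.card {a // p a ∧ R a b} = k)
    (hR : ∀ a b, p a → q b → R a b → (Y a ↔ Z b)) :
    Nat.card {a // p a ∧ Y a} * l = Nat.card {b // q b ∧ Z b} * k := by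
  classical
  have := Fintype.ofFinite A
  have := Fintype.ofFinite B
  have h₁ : Nat.card {a // p a ∧ Y a} * l =
      Nat.card (Σ a : {a // p a ∧ Y a}, {b // q b ∧ R a b}) := by
    rw [Nat.card_sigma, Finset.sum_congr rfl fun a _ => hl a.1 a.2.1]
    simp
  have h₂ : Nat.card {b // q b ∧ Z b} * k =
      Nat.card (Σ b : {b // q b ∧ Z b}, {a // p a ∧ R a b}) := by
    rw [Nat.card_sigma, Finset.sum_congr rfl fun b _ => hk b.1 b.2.1]
    simp
  rw [h₁, h₂]
  exact Nat.card_congr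
    { toFun := fun s => ⟨⟨s.2.1, s.2.2.1, (hR _ _ s.1.2.1 s.2.2.1 s.2.2.2).1 s.1.2.2⟩,
        ⟨s.1.1, s.1.2.1, s.2.2.2⟩⟩
      invFun := fun s => ⟨⟨s.2.1, s.2.2.1, (hR _ _ s.2.2.1 s.1.2.1 s.2.2.2).2 s.1.2.2⟩,
        ⟨s.1.1, s.1.2.1, s.2.2.2⟩⟩
      left_inv := fun _ => rfl
      right_inv := fun _ => rfl }

/-- Summing over the values of a map, weighted by the sizes of its fibres. -/
lemma finsum_mul_card_fiber {A B : Type*} [Fintype A] (φ : A → B) (F : B → ℚ) :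
    ∑ᶠ b, F b * (Nat.card {a // φ a = b} : ℚ) = ∑ a, F (φ a) := by
  classical
  rw [finsum_eq_sum_of_support_subset (s := Finset.univ.image φ), Finset.sum_comp]
  · refine Finset.sum_congr rfl fun b _ => ?_
    rw [Nat.card_eq_fintype_card, Fintype.card_subtype, nsmul_eq_mul, mul_comm]
  · intro b hb
    by_contra hn
    refine hb ?_
    have : IsEmpty {a // φ a = b} := ⟨fun a => hn (by simpa using ⟨a.1, a.2⟩)⟩
    simp

/-- A nonempty set on which translation by a kernel acts simply transitively. -/
lemma card_eq_of_torsor {A : Type*} [AddGroup A] {P Q : A → Prop} (a₀ : A)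
    (h : ∀ a, P (a + a₀) ↔ Q a) : Nat.card {a // P a} = Nat.card {a // Q a} :=
  Nat.card_congr ((Equiv.addRight a₀).subtypeEquiv fun a => (h a).symm).symm

/-- Counting a finite set by the fibres of a map. -/
lemma card_eq_sum_card_fiber {A B : Type*} [Finite A] [Fintype B] (φ : A → B) :
    Nat.card A = ∑ b, Nat.card {a // φ a = b} := by
  rw [← Nat.card_sigma]
  exact Nat.card_congr (Equiv.sigmaFiberEquiv φ).symm

end Counting

set_option linter.unusedSectionVars false

variable {T}

section Triangles

variable {x y z : T} {f : x ⟶ z} {g : z ⟶ y} {h : y ⟶ x⟦(1 : ℤ)⟧}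

lemma exists_cone (f : x ⟶ z) : ∃ (y : T) (g : z ⟶ y) (h : y ⟶ x⟦(1 : ℤ)⟧),
    Triangle.mk f g h ∈ distTriang T := distinguished_cocone_triangle f

lemma exists_cocone (g : z ⟶ y) : ∃ (x : T) (f : x ⟶ z) (h : y ⟶ x⟦(1 : ℤ)⟧),
    Triangle.mk f g h ∈ distTriang T := distinguished_cocone_triangle₁ g

lemma rotate_mem (H : Triangle.mk f g h ∈ distTriang T) :
    Triangle.mk g h (-f⟦(1 : ℤ)⟧') ∈ distTriang T := rot_of_distTriang _ H

lemma comp_fg (H : Triangle.mk f g h ∈ distTriang T) : f ≫ g = 0 :=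
  comp_distTriang_mor_zero₁₂ _ H

lemma comp_gh (H : Triangle.mk f g h ∈ distTriang T) : g ≫ h = 0 :=
  comp_distTriang_mor_zero₂₃ _ H

lemma comp_hf (H : Triangle.mk f g h ∈ distTriang T) : h ≫ f⟦(1 : ℤ)⟧' = 0 :=
  comp_distTriang_mor_zero₃₁ _ H

lemma post_exact (H : Triangle.mk f g h ∈ distTriang T) {t : T} {u : t ⟶ z} (hu : u ≫ g = 0) :
    ∃ v : t ⟶ x, u = v ≫ f := Triangle.coyoneda_exact₂ _ H u hu

lemma pre_exact (H : Triangle.mk f g h ∈ distTriang T) {t : T} {u : z ⟶ t} (hu : f ≫ u = 0) :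
    ∃ v : y ⟶ t, u = g ≫ v := Triangle.yoneda_exact₂ _ H u hu

lemma exists_third {x' y' z' : T} {f' : x' ⟶ z'} {g' : z' ⟶ y'} {h' : y' ⟶ x'⟦(1 : ℤ)⟧}
    (H : Triangle.mk f g h ∈ distTriang T) (H' : Triangle.mk f' g' h' ∈ distTriang T)
    (a : x ⟶ x') (b : z ⟶ z') (comm : f ≫ b = a ≫ f') :
    ∃ c : y ⟶ y', g ≫ c = b ≫ g' ∧ h ≫ a⟦(1 : ℤ)⟧' = c ≫ h' :=
  complete_distinguished_triangle_morphism _ _ H H' a b comm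

lemma exists_first {x' y' z' : T} {f' : x' ⟶ z'} {g' : z' ⟶ y'} {h' : y' ⟶ x'⟦(1 : ℤ)⟧}
    (H : Triangle.mk f g h ∈ distTriang T) (H' : Triangle.mk f' g' h' ∈ distTriang T)
    (b : z ⟶ z') (c : y ⟶ y') (comm : g ≫ c = b ≫ g') :
    ∃ a : x ⟶ x', f ≫ b = a ≫ f' ∧ h ≫ a⟦(1 : ℤ)⟧' = c ≫ h' :=
  complete_distinguished_triangle_morphism₁ _ _ H H' b c comm

lemma mem_of_iso {x' y' z' : T} {f' : x' ⟶ z'} {g' : z' ⟶ y'} {h' : y' ⟶ x'⟦(1 : ℤ)⟧}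
    (H : Triangle.mk f g h ∈ distTriang T) (a : x ≅ x') (b : z ≅ z') (c : y ≅ y')
    (h₁ : f ≫ b.hom = a.hom ≫ f') (h₂ : g ≫ c.hom = b.hom ≫ g')
    (h₃ : h ≫ a.hom⟦(1 : ℤ)⟧' = c.hom ≫ h') : Triangle.mk f' g' h' ∈ distTriang T :=
  isomorphic_distinguished _ H _ (Triangle.isoMk _ _ a b c h₁ h₂ h₃).symm

lemma exists_third_iso {x' y' z' : T} {f' : x' ⟶ z'} {g' : z' ⟶ y'} {h' : y' ⟶ x'⟦(1 : ℤ)⟧}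
    (H : Triangle.mk f g h ∈ distTriang T) (H' : Triangle.mk f' g' h' ∈ distTriang T)
    (a : x ≅ x') (b : z ≅ z') (comm : f ≫ b.hom = a.hom ≫ f') :
    ∃ c : y ≅ y', g ≫ c.hom = b.hom ≫ g' ∧ h ≫ a.hom⟦(1 : ℤ)⟧' = c.hom ≫ h' := by
  obtain ⟨c, h₁, h₂⟩ := exists_third H H' a.hom b.hom comm
  have : IsIso c := isIso₃_of_isIso₁₂
    (Triangle.homMk (Triangle.mk f g h) (Triangle.mk f' g' h') a.hom b.hom c comm h₁ h₂) H H'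
    (inferInstanceAs (IsIso a.hom)) (inferInstanceAs (IsIso b.hom))
  exact ⟨asIso c, h₁, h₂⟩

lemma exists_first_iso {x' y' z' : T} {f' : x' ⟶ z'} {g' : z' ⟶ y'} {h' : y' ⟶ x'⟦(1 : ℤ)⟧}
    (H : Triangle.mk f g h ∈ distTriang T) (H' : Triangle.mk f' g' h' ∈ distTriang T)
    (b : z ≅ z') (c : y ≅ y') (comm : g ≫ c.hom = b.hom ≫ g') :
    ∃ a : x ≅ x', f ≫ b.hom = a.hom ≫ f' ∧ h ≫ a.hom⟦(1 : ℤ)⟧' = c.hom ≫ h' := by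
  obtain ⟨a, h₁, h₂⟩ := exists_first H H' b.hom c.hom comm
  have : IsIso a := isIso₁_of_isIso₂₃
    (Triangle.homMk (Triangle.mk f g h) (Triangle.mk f' g' h') a b.hom c.hom h₁ comm h₂) H H'
    (inferInstanceAs (IsIso b.hom)) (inferInstanceAs (IsIso c.hom))
  exact ⟨asIso a, h₁, h₂⟩

lemma exists_second_iso {x' y' z' : T} {f' : x' ⟶ z'} {g' : z' ⟶ y'} {h' : y' ⟶ x'⟦(1 : ℤ)⟧}
    (H : Triangle.mk f g h ∈ distTriang T) (H' : Triangle.mk f' g' h' ∈ distTriang T)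
    (a : x ≅ x') (c : y ≅ y') (comm : h ≫ a.hom⟦(1 : ℤ)⟧' = c.hom ≫ h') :
    Nonempty (z ≅ z') := by
  obtain ⟨b, h₁, h₂⟩ : ∃ b : z ⟶ z', f ≫ b = a.hom ≫ f' ∧ g ≫ c.hom = b ≫ g' :=
    complete_distinguished_triangle_morphism₂ _ _ H H' a.hom c.hom comm
  have : IsIso b := isIso₂_of_isIso₁₃
    (Triangle.homMk (Triangle.mk f g h) (Triangle.mk f' g' h') a.hom b c.hom h₁ h₂ comm) H H'
    (inferInstanceAs (IsIso a.hom)) (inferInstanceAs (IsIso c.hom))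
  exact ⟨asIso b⟩

end Triangles

section Ranks

/-- The rank of postcomposition with `f` on `Hom(t, -)`. -/
noncomputable def rkPost {x y : T} (t : T) (f : x ⟶ y) : ℕ :=
  Nat.card (Set.range fun u : t ⟶ x => u ≫ f)

/-- The rank of precomposition with `f` on `Hom(-, t)`. -/
noncomputable def rkPre {x y : T} (f : x ⟶ y) (t : T) : ℕ :=
  Nat.card (Set.range fun u : y ⟶ t => f ≫ u)

/-- The order of the kernel of postcomposition with `f` on `Hom(t, -)`. -/
noncomputable def kerPost {x y : T} (t : T) (f : x ⟶ y) : ℕ :=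
  Nat.card {u : t ⟶ x // u ≫ f = 0}

/-- The order of the kernel of precomposition with `f` on `Hom(-, t)`. -/
noncomputable def kerPre {x y : T} (f : x ⟶ y) (t : T) : ℕ :=
  Nat.card {u : y ⟶ t // f ≫ u = 0}

lemma card_eq_kerPost_mul_rkPost {x y : T} (t : T) (f : x ⟶ y) :
    Nat.card (t ⟶ x) = kerPost t f * rkPost t f :=
  card_eq_card_ker_mul_card_range (Preadditive.rightComp t f)

lemma card_eq_kerPre_mul_rkPre {x y : T} (f : x ⟶ y) (t : T) :
    Nat.card (y ⟶ t) = kerPre f t * rkPre f t :=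
  card_eq_card_ker_mul_card_range (Preadditive.leftComp t f)

lemma rkPost_neg {x y : T} (t : T) (f : x ⟶ y) : rkPost t (-f) = rkPost t f := by
  unfold rkPost
  congr 2
  ext u
  constructor
  · rintro ⟨v, rfl⟩
    exact ⟨-v, by simp⟩
  · rintro ⟨v, rfl⟩
    exact ⟨-v, by simp⟩

lemma rkPre_neg {x y : T} (f : x ⟶ y) (t : T) : rkPre (-f) t = rkPre f t := by
  unfold rkPre
  congr 2
  ext u
  constructor
  · rintro ⟨v, rfl⟩
    exact ⟨-v, by simp⟩
  · rintro ⟨v, rfl⟩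
    exact ⟨-v, by simp⟩

lemma rkPost_shift {x y : T} (t : T) (f : x ⟶ y) :
    rkPost (t⟦(1 : ℤ)⟧) (f⟦(1 : ℤ)⟧') = rkPost t f := by
  let e : ∀ a b : T, (a ⟶ b) ≃ (a⟦(1 : ℤ)⟧ ⟶ b⟦(1 : ℤ)⟧) :=
    fun _ _ => (Functor.FullyFaithful.ofFullyFaithful (shiftFunctor T (1 : ℤ))).homEquiv
  refine (Nat.card_congr ((e t y).subtypeEquiv fun u => ?_)).symm
  constructor
  · rintro ⟨v, rfl⟩
    exact ⟨v⟦1⟧', ((shiftFunctor T (1 : ℤ)).map_comp v f).symm⟩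
  · rintro ⟨v, hv⟩
    obtain ⟨v, rfl⟩ := (e t x).surjective v
    refine ⟨v, (e t y).injective ?_⟩
    rw [← hv]
    exact (shiftFunctor T (1 : ℤ)).map_comp v f

lemma card_hom_shift (x y : T) : Nat.card (x⟦(1 : ℤ)⟧ ⟶ y⟦(1 : ℤ)⟧) = Nat.card (x ⟶ y) :=
  (Nat.card_congr
    (Functor.FullyFaithful.ofFullyFaithful (shiftFunctor T (1 : ℤ))).homEquiv).symm

lemma card_hom_congr {x y x' y' : T} (a : x ≅ x') (b : y ≅ y') :
    Nat.card (x ⟶ y) = Nat.card (x' ⟶ y') := Nat.card_congr (a.homCongr b)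

variable {x y z : T} {f : x ⟶ z} {g : z ⟶ y} {h : y ⟶ x⟦(1 : ℤ)⟧}

lemma kerPost_eq_rkPost (H : Triangle.mk f g h ∈ distTriang T) (t : T) :
    kerPost t g = rkPost t f := by
  refine Nat.card_congr (Equiv.subtypeEquivRight fun u => ?_)
  constructor
  · intro hu
    obtain ⟨v, rfl⟩ := post_exact H hu
    exact ⟨v, rfl⟩
  · rintro ⟨v, rfl⟩
    simp [comp_fg H]

lemma kerPre_eq_rkPre (H : Triangle.mk f g h ∈ distTriang T) (t : T) :
    kerPre f t = rkPre g t := by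
  refine Nat.card_congr (Equiv.subtypeEquivRight fun u => ?_)
  constructor
  · intro hu
    obtain ⟨v, rfl⟩ := pre_exact H hu
    exact ⟨v, rfl⟩
  · rintro ⟨v, rfl⟩
    simp [← Category.assoc, comp_fg H]

lemma card_post_two (H : Triangle.mk f g h ∈ distTriang T) (t : T) :
    Nat.card (t ⟶ z) = rkPost t f * rkPost t g := by
  rw [card_eq_kerPost_mul_rkPost t g, kerPost_eq_rkPost H]

lemma card_post_three (H : Triangle.mk f g h ∈ distTriang T) (t : T) :
    Nat.card (t ⟶ y) = rkPost t g * rkPost t h := card_post_two (rotate_mem H) t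

lemma card_post_one (H : Triangle.mk f g h ∈ distTriang T) (t : T) :
    Nat.card (t ⟶ x⟦(1 : ℤ)⟧) = rkPost t h * rkPost t (f⟦(1 : ℤ)⟧') := by
  rw [card_post_two (rotate_mem (rotate_mem H)) t, rkPost_neg]

lemma card_pre_two (H : Triangle.mk f g h ∈ distTriang T) (t : T) :
    Nat.card (z ⟶ t) = rkPre g t * rkPre f t := by
  rw [card_eq_kerPre_mul_rkPre f t, kerPre_eq_rkPre H]

lemma card_pre_three (H : Triangle.mk f g h ∈ distTriang T) (t : T) :
    Nat.card (y ⟶ t) = rkPre h t * rkPre g t := card_pre_two (rotate_mem H) t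

lemma card_pre_one (H : Triangle.mk f g h ∈ distTriang T) (t : T) :
    Nat.card (x⟦(1 : ℤ)⟧ ⟶ t) = rkPre (f⟦(1 : ℤ)⟧') t * rkPre h t := by
  rw [card_pre_two (rotate_mem (rotate_mem H)) t, rkPre_neg]

variable [∀ x y : T, Finite (x ⟶ y)]

lemma rkPost_pos {x y : T} (t : T) (f : x ⟶ y) : 0 < rkPost t f :=
  have : Nonempty (Set.range fun u : t ⟶ x => u ≫ f) := ⟨⟨_, 0, rfl⟩⟩
  Nat.card_pos

lemma rkPre_pos {x y : T} (f : x ⟶ y) (t : T) : 0 < rkPre f t :=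
  have : Nonempty (Set.range fun u : y ⟶ t => f ≫ u) := ⟨⟨_, 0, rfl⟩⟩
  Nat.card_pos

lemma kerPost_pos {x y : T} (t : T) (f : x ⟶ y) : 0 < kerPost t f :=
  have : Nonempty {u : t ⟶ x // u ≫ f = 0} := ⟨⟨0, by simp⟩⟩
  Nat.card_pos

lemma kerPre_pos {x y : T} (f : x ⟶ y) (t : T) : 0 < kerPre f t :=
  have : Nonempty {u : y ⟶ t // f ≫ u = 0} := ⟨⟨0, by simp⟩⟩
  Nat.card_pos

lemma card_hom_pos (x y : T) : 0 < Nat.card (x ⟶ y) :=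
  have : Nonempty (x ⟶ y) := ⟨0⟩
  Nat.card_pos

end Ranks

section Vanishing

/-- All the groups `Ext^{-j}(x, y)` with `j ≥ k` vanish. -/
def VanishesFrom (k : ℕ) (x y : T) : Prop :=
  ∀ j : ℕ, k ≤ j → Subsingleton (x ⟶ y⟦(-(j : ℤ))⟧)

/-- Moving a shift from the first to the second argument. -/
noncomputable def shiftLeftEquiv (x y : T) (m n : ℤ) (hmn : m + 1 = n) :
    (x ⟶ y⟦m⟧) ≃ (x⟦(1 : ℤ)⟧ ⟶ y⟦n⟧) :=
  (Functor.FullyFaithful.ofFullyFaithful (shiftFunctor T (1 : ℤ))).homEquiv.trans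
    (Iso.homCongr (Iso.refl _) ((shiftFunctorAdd' T m 1 n hmn).app y).symm)

/-- Combining two shifts of the second argument. -/
noncomputable def shiftRightEquiv (x y : T) (l m n : ℤ) (h : l + m = n) :
    (x ⟶ y⟦l⟧⟦m⟧) ≃ (x ⟶ y⟦n⟧) :=
  Iso.homCongr (Iso.refl _) ((shiftFunctorAdd' T l m n h).app y).symm

lemma VanishesFrom.mono {k l : ℕ} {x y : T} (h : VanishesFrom k x y) (hkl : k ≤ l) :
    VanishesFrom l x y := fun j hj => h j (hkl.trans hj)

lemma VanishesFrom.shift_left {k : ℕ} {x y : T} (h : VanishesFrom (k + 1) x y) :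
    VanishesFrom k (x⟦(1 : ℤ)⟧) y := fun j hj =>
  have := h (j + 1) (by lia)
  (shiftLeftEquiv x y (-((j + 1 : ℕ) : ℤ)) (-(j : ℤ)) (by push_cast; ring)).symm.subsingleton

lemma VanishesFrom.shift_right {k : ℕ} {x y : T} (h : VanishesFrom (k + 1) x y) :
    VanishesFrom k x (y⟦(-1 : ℤ)⟧) := fun j hj =>
  have := h (j + 1) (by lia)
  (shiftRightEquiv x y (-1) (-(j : ℤ)) (-((j + 1 : ℕ) : ℤ)) (by push_cast; ring)).subsingleton

lemma VanishesFrom.subsingleton {x y : T} (h : VanishesFrom 0 x y) : Subsingleton (x ⟶ y) :=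
  have := h 0 le_rfl
  (Iso.homCongr (Iso.refl x) ((shiftFunctorZero' T (-((0 : ℕ) : ℤ)) (by simp)).app y)).symm.subsingleton

lemma Finitary.exists_vanishesFrom (hfin : Finitary T) (x y : T) : ∃ k, VanishesFrom k x y := by
  obtain ⟨k, hk⟩ := hfin x y
  exact ⟨k, fun j hj => ⟨fun f g => (hk j hj f).trans (hk j hj g).symm⟩⟩

end Vanishing

section HomCounting

variable [∀ x y : T, Finite (x ⟶ y)]

/-- If `a` and `b` receive equally many morphisms from every object, then the ranks of a morphism
on `Hom(-, a)` and on `Hom(-, b)` agree, by descending induction along the shifts. -/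
lemma rkPre_eq_of_card_hom_eq {a b : T} (hab : ∀ t : T, Nat.card (t ⟶ a) = Nat.card (t ⟶ b))
    (k : ℕ) : ∀ {s t : T} (φ : s ⟶ t), VanishesFrom k t a → VanishesFrom k t b →
      rkPre φ a = rkPre φ b := by
  induction k with
  | zero =>
    intro s t φ ha hb
    have h : ∀ c : T, VanishesFrom 0 t c → rkPre φ c = 1 := fun c hc => by
      have := hc.subsingleton
      have h₁ := card_eq_kerPre_mul_rkPre φ c
      have h₂ : Nat.card (t ⟶ c) = 1 := Nat.card_eq_one_iff_unique.2 ⟨this, ⟨0⟩⟩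
      rw [h₂] at h₁
      exact Nat.eq_one_of_mul_eq_one_left h₁.symm
    rw [h a ha, h b hb]
  | succ k ih =>
    intro s t φ ha hb
    obtain ⟨c, ψ, χ, H⟩ := exists_cone φ
    have h₁ := ih (φ⟦(1 : ℤ)⟧') ha.shift_left hb.shift_left
    have key : ∀ d : T, Nat.card (c ⟶ d) * (rkPre φ d * rkPre (φ⟦(1 : ℤ)⟧') d) =
        Nat.card (t ⟶ d) * Nat.card (s⟦(1 : ℤ)⟧ ⟶ d) := fun d => by
      rw [card_pre_two H, card_pre_three H, card_pre_one H]
      ring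
    have h₂ := key a
    rw [hab c, hab t, hab (s⟦(1 : ℤ)⟧), ← key b, h₁] at h₂
    exact Nat.eq_of_mul_eq_mul_right (rkPre_pos _ _)
      (Nat.eq_of_mul_eq_mul_left (card_hom_pos c b) h₂)

lemma kerPre_eq_of_card_hom_eq (hfin : Finitary T) {a b : T}
    (hab : ∀ t : T, Nat.card (t ⟶ a) = Nat.card (t ⟶ b)) {s t : T} (φ : s ⟶ t) :
    kerPre φ a = kerPre φ b := by
  obtain ⟨k, hk⟩ := hfin.exists_vanishesFrom t a
  obtain ⟨l, hl⟩ := hfin.exists_vanishesFrom t b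
  have h := rkPre_eq_of_card_hom_eq hab (max k l) φ (hk.mono (le_max_left k l))
    (hl.mono (le_max_right k l))
  have h₁ := hab t
  rw [card_eq_kerPre_mul_rkPre φ a, card_eq_kerPre_mul_rkPre φ b, h] at h₁
  exact Nat.eq_of_mul_eq_mul_right (rkPre_pos _ _) h₁

/-- By inclusion-exclusion, `a` and `b` also receive equally many morphisms from `t` that do not
kill any member of a given finite family of morphisms into `t`. -/
lemma card_not_killing_eq (hfin : Finitary T) {a b : T}
    (hab : ∀ t : T, Nat.card (t ⟶ a) = Nat.card (t ⟶ b)) {t : T} {ι : Type*} [Finite ι]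
    (s : ι → T) (u : ∀ i, s i ⟶ t) :
    Nat.card {f : t ⟶ a // ∀ i, u i ≫ f ≠ 0} = Nat.card {f : t ⟶ b // ∀ i, u i ≫ f ≠ 0} := by
  classical
  have := Fintype.ofFinite ι
  have : ∀ x y : T, Fintype (x ⟶ y) := fun x y => Fintype.ofFinite _
  have key : ∀ c : T, (Nat.card {f : t ⟶ c // ∀ i, u i ≫ f ≠ 0} : ℤ) =
      ∑ V ∈ (Finset.univ : Finset ι).powerset, (-1 : ℤ) ^ V.card *
        kerPre (biproduct.desc fun i : V => u i) c := fun c => by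
    have h := Finset.inclusion_exclusion_card_inf_compl (Finset.univ : Finset ι)
      (fun i => (Finset.univ : Finset (t ⟶ c)).filter fun f => u i ≫ f = 0)
    have h₁ : ((Finset.univ : Finset ι).inf fun i =>
        ((Finset.univ : Finset (t ⟶ c)).filter fun f => u i ≫ f = 0)ᶜ).card =
        Nat.card {f : t ⟶ c // ∀ i, u i ≫ f ≠ 0} := by
      rw [Nat.card_eq_fintype_card, Fintype.card_subtype]
      congr 1
      ext f
      simp [Finset.mem_inf]
    rw [h₁] at h
    rw [h]
    refine Finset.sum_congr rfl fun V _ => ?_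
    congr 2
    rw [kerPre, Nat.card_eq_fintype_card, Fintype.card_subtype]
    congr 1
    ext f
    simp only [Finset.mem_inf, Finset.mem_filter, Finset.mem_univ, true_and]
    constructor
    · intro hf
      refine biproduct.hom_ext' _ _ fun i => ?_
      simpa using hf i i.2
    · intro hf i hi
      have := biproduct.ι (fun i : V => s i) ⟨i, hi⟩ ≫= hf
      simpa using this
  have h : (Nat.card {f : t ⟶ a // ∀ i, u i ≫ f ≠ 0} : ℤ) =
      Nat.card {f : t ⟶ b // ∀ i, u i ≫ f ≠ 0} := by
    rw [key a, key b]
    refine Finset.sum_congr rfl fun V _ => ?_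
    rw [kerPre_eq_of_card_hom_eq hfin hab]
  exact_mod_cast h

lemma exists_not_killing (hfin : Finitary T) {a b : T}
    (hab : ∀ t : T, Nat.card (t ⟶ a) = Nat.card (t ⟶ b)) :
    ∃ f : a ⟶ b, (∀ u : a ⟶ a, u ≫ f = 0 → u = 0) ∧ (∀ u : b ⟶ a, u ≫ f = 0 → u = 0) := by
  let ι := {u : a ⟶ a // u ≠ 0} ⊕ {u : b ⟶ a // u ≠ 0}
  let s : ι → T := Sum.elim (fun _ => a) (fun _ => b)
  let u : ∀ i, s i ⟶ a := fun i => match i with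
    | Sum.inl v => v.1
    | Sum.inr v => v.1
  have h := card_not_killing_eq hfin hab s u
  have h₁ : Nonempty {f : a ⟶ a // ∀ i, u i ≫ f ≠ 0} := by
    refine ⟨⟨𝟙 a, ?_⟩⟩
    rintro (v | v)
    · show v.1 ≫ 𝟙 a ≠ 0
      rw [Category.comp_id]
      exact v.2
    · show v.1 ≫ 𝟙 a ≠ 0
      rw [Category.comp_id]
      exact v.2
  have h₂ : 0 < Nat.card {f : a ⟶ b // ∀ i, u i ≫ f ≠ 0} := h ▸ Nat.card_pos
  obtain ⟨f, hf⟩ := (Nat.card_pos_iff.1 h₂).1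
  refine ⟨f, fun v hv => ?_, fun v hv => ?_⟩
  · by_contra hne
    exact hf (Sum.inl ⟨v, hne⟩) hv
  · by_contra hne
    exact hf (Sum.inr ⟨v, hne⟩) hv

/-- An endomorphism of an object with finite endomorphism ring is invertible as soon as
composing with it is injective. -/
lemma isIso_of_comp_eq_zero {a : T} (e : a ⟶ a) (he : ∀ u : a ⟶ a, u ≫ e = 0 → u = 0) :
    IsIso e := by
  have hinj : Function.Injective fun u : a ⟶ a => u ≫ e := fun u v huv =>
    sub_eq_zero.1 (he _ (by simpa [Preadditive.sub_comp, sub_eq_zero] using huv))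
  obtain ⟨v, hv⟩ := Finite.injective_iff_surjective.1 hinj (𝟙 a)
  have hv : v ≫ e = 𝟙 a := hv
  exact ⟨v, hinj (by simp [hv]), hv⟩

/-- In a finitary pretriangulated category, an object is determined up to isomorphism by the
numbers of morphisms into it. -/
lemma nonempty_iso_of_card_hom_eq (hfin : Finitary T) {a b : T}
    (hab : ∀ t : T, Nat.card (t ⟶ a) = Nat.card (t ⟶ b)) : Nonempty (a ≅ b) := by
  obtain ⟨f, hfa, hfb⟩ := exists_not_killing hfin hab
  obtain ⟨g, hgb, hga⟩ := exists_not_killing hfin fun t => (hab t).symm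
  have h₁ : IsIso (f ≫ g) := isIso_of_comp_eq_zero _ fun u hu =>
    hfa _ (hga _ (by simpa using hu))
  have h₂ : IsIso (g ≫ f) := isIso_of_comp_eq_zero _ fun u hu =>
    hgb _ (hfb _ (by simpa using hu))
  have : Mono f := mono_of_mono f g
  have : IsSplitEpi f := ⟨⟨⟨inv (g ≫ f) ≫ g, by simp⟩⟩⟩
  have : IsIso f := isIso_of_mono_of_isSplitEpi f
  exact ⟨asIso f⟩

end HomCounting

section Matching

variable {x m z w w' : T} {f : x ⟶ m} {j : m ⟶ w'} {d : w' ⟶ x⟦(1 : ℤ)⟧}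
  {i : w ⟶ m} {g : m ⟶ z} {d' : z ⟶ w⟦(1 : ℤ)⟧}

lemma rkPost_shift_lift (A : Triangle.mk f j d ∈ distTriang T) {l : x ⟶ w} (hl : l ≫ i = f)
    (t : T) : rkPost t (l⟦(1 : ℤ)⟧') = rkPost t (d ≫ l⟦(1 : ℤ)⟧') * rkPost t (f⟦(1 : ℤ)⟧') := by
  have h := card_range_eq_mul (Preadditive.rightComp t (l⟦(1 : ℤ)⟧'))
    (Preadditive.rightComp t (i⟦(1 : ℤ)⟧'))
  have h₁ : (l⟦(1 : ℤ)⟧') ≫ i⟦(1 : ℤ)⟧' = f⟦(1 : ℤ)⟧' := by rw [← Functor.map_comp, hl]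
  refine h.trans ?_
  congr 1
  · refine Nat.card_congr (Equiv.subtypeEquivRight fun u => ?_)
    constructor
    · rintro ⟨⟨v, rfl⟩, hv⟩
      have hv : (v ≫ l⟦(1 : ℤ)⟧') ≫ i⟦(1 : ℤ)⟧' = 0 := hv
      rw [Category.assoc, h₁] at hv
      obtain ⟨c, rfl⟩ := Triangle.coyoneda_exact₁ _ A v hv
      exact ⟨c, (Category.assoc _ _ _).symm⟩
    · rintro ⟨v, rfl⟩
      refine ⟨⟨v ≫ d, Category.assoc _ _ _⟩, ?_⟩
      show (v ≫ d ≫ l⟦(1 : ℤ)⟧') ≫ i⟦(1 : ℤ)⟧' = 0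
      rw [Category.assoc, Category.assoc, h₁, comp_hf A, comp_zero]
  · refine congrArg (fun s : Set _ => Nat.card s) (congrArg Set.range (funext fun v => ?_))
    show (v ≫ l⟦(1 : ℤ)⟧') ≫ i⟦(1 : ℤ)⟧' = v ≫ f⟦(1 : ℤ)⟧'
    rw [Category.assoc, h₁]

lemma rkPost_desc (B : Triangle.mk i g d' ∈ distTriang T) {g' : w' ⟶ z} (hg : j ≫ g' = g)
    (t : T) : rkPost t g' = rkPost t g * rkPost t (g' ≫ d') := by
  refine (card_range_eq_mul (Preadditive.rightComp t g') (Preadditive.rightComp t d')).trans ?_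
  congr 1
  · refine Nat.card_congr (Equiv.subtypeEquivRight fun u => ?_)
    constructor
    · rintro ⟨-, hu⟩
      obtain ⟨v, rfl⟩ := post_exact (rotate_mem B) hu
      exact ⟨v, rfl⟩
    · rintro ⟨v, rfl⟩
      refine ⟨⟨v ≫ j, (Category.assoc _ _ _).trans (by rw [hg])⟩, ?_⟩
      show (v ≫ g) ≫ d' = 0
      rw [Category.assoc, comp_gh B, comp_zero]
  · exact congrArg (fun s : Set _ => Nat.card s)
      (congrArg Set.range (funext fun v => Category.assoc _ _ _))

variable [∀ x y : T, Finite (x ⟶ y)]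

/-- A substitute for the octahedral axiom: given a morphism of triangles `(l, 𝟙, g')`, the cone
of `l` and the cocone of `g'` are isomorphic. -/
lemma nonempty_iso_of_morphism (hfin : Finitary T) (A : Triangle.mk f j d ∈ distTriang T)
    (B : Triangle.mk i g d' ∈ distTriang T) {l : x ⟶ w} (hl : l ≫ i = f) {g' : w' ⟶ z}
    (hg : j ≫ g' = g) (comm : d ≫ l⟦(1 : ℤ)⟧' = g' ≫ d') {y y' : T} {p : w ⟶ y}
    {q : y ⟶ x⟦(1 : ℤ)⟧} (C : Triangle.mk l p q ∈ distTriang T) {a : y' ⟶ w'}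
    {b : z ⟶ y'⟦(1 : ℤ)⟧} (D : Triangle.mk a g' b ∈ distTriang T) : Nonempty (y ≅ y') := by
  refine nonempty_iso_of_card_hom_eq hfin fun t => ?_
  have l₁ := rkPost_shift_lift A hl t
  have l₀ := rkPost_shift_lift A hl (t⟦(1 : ℤ)⟧)
  have g₀ := rkPost_desc B hg t
  have g₁ := rkPost_desc B hg (t⟦(1 : ℤ)⟧)
  rw [rkPost_shift, rkPost_shift] at l₀
  rw [← comm] at g₀ g₁
  have c₁ := card_post_three C t
  have c₂ := card_post_two C t
  have c₃ := card_post_one C t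
  have d₁ := card_post_one D (t⟦(1 : ℤ)⟧)
  have d₂ := card_post_two D t
  have d₃ := card_post_three D (t⟦(1 : ℤ)⟧)
  rw [card_hom_shift, rkPost_shift] at d₁
  have a₁ := card_post_three A t
  have a₂ := card_post_two A t
  have a₃ := card_post_one A t
  have b₁ := card_post_one B (t⟦(1 : ℤ)⟧)
  have b₂ := card_post_two B t
  have b₃ := card_post_three B (t⟦(1 : ℤ)⟧)
  rw [card_hom_shift, rkPost_shift] at b₁
  have hy : Nat.card (t ⟶ y) * (rkPost t l * rkPost t (l⟦(1 : ℤ)⟧')) =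
      Nat.card (t ⟶ w) * Nat.card (t ⟶ x⟦(1 : ℤ)⟧) := by rw [c₁, c₂, c₃]; ring
  have hy' : Nat.card (t ⟶ y') * (rkPost t g' * rkPost (t⟦(1 : ℤ)⟧) g') =
      Nat.card (t⟦(1 : ℤ)⟧ ⟶ z) * Nat.card (t ⟶ w') := by rw [d₁, d₂, d₃]; ring
  rw [l₀, l₁] at hy
  rw [g₀, g₁] at hy'
  rw [b₁, a₃] at hy
  rw [b₃, a₁] at hy'
  have hab := a₂.symm.trans b₂
  have p₁ := rkPost_pos t f
  have p₂ := rkPost_pos t (f⟦(1 : ℤ)⟧')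
  have p₃ := rkPost_pos t (d ≫ l⟦(1 : ℤ)⟧')
  have p₄ := rkPost_pos (t⟦(1 : ℤ)⟧) (d ≫ l⟦(1 : ℤ)⟧')
  have p₅ := rkPost_pos t g
  have p₆ := rkPost_pos (t⟦(1 : ℤ)⟧) g
  refine Nat.eq_of_mul_eq_mul_right (m := rkPost t f * rkPost t (f⟦(1 : ℤ)⟧') *
    rkPost t (d ≫ l⟦(1 : ℤ)⟧') * rkPost (t⟦(1 : ℤ)⟧) (d ≫ l⟦(1 : ℤ)⟧') * rkPost t g *
    rkPost (t⟦(1 : ℤ)⟧) g) (by positivity) ?_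
  calc _ = (rkPost (t⟦(1 : ℤ)⟧) d' * rkPost t i * (rkPost t d * rkPost t (f⟦(1 : ℤ)⟧'))) *
        (rkPost t g * rkPost (t⟦(1 : ℤ)⟧) g) := by rw [← hy]; ring
    _ = (rkPost t f * rkPost t j) * (rkPost (t⟦(1 : ℤ)⟧) d' * rkPost t d *
        rkPost t (f⟦(1 : ℤ)⟧') * rkPost (t⟦(1 : ℤ)⟧) g) := by rw [hab]; ring
    _ = (rkPost (t⟦(1 : ℤ)⟧) g * rkPost (t⟦(1 : ℤ)⟧) d' * (rkPost t j * rkPost t d)) *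
        (rkPost t f * rkPost t (f⟦(1 : ℤ)⟧')) := by ring
    _ = _ := by rw [← hy']; ring

end Matching

section AltProd

variable [∀ x y : T, Finite (x ⟶ y)]

lemma extAltProd_congr {x y x' y' : T} (a : x ≅ x') (b : y ≅ y') :
    extAltProd T x y = extAltProd T x' y' := by
  unfold extAltProd
  refine finprod_congr fun i => ?_
  rw [card_hom_congr a ((shiftFunctor T _).mapIso b)]

lemma extAltProd_ne_zero (x y : T) : extAltProd T x y ≠ 0 := by
  refine finprod_induction (p := fun q : ℚ => q ≠ 0) one_ne_zero (fun _ _ => mul_ne_zero)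
    fun i => zpow_ne_zero _ ?_
  exact_mod_cast (card_hom_pos _ _).ne'

lemma extAltProd_eq_one {x y : T} (h : VanishesFrom 0 x y) : extAltProd T x y = 1 := by
  refine finprod_eq_one_of_forall_eq_one fun i => ?_
  have h₁ : Nat.card (x ⟶ y⟦(-(i : ℤ) - 1)⟧) = 1 := by
    have := h (i + 1) (by lia)
    rw [show (-(i : ℤ) - 1) = -((i + 1 : ℕ) : ℤ) by push_cast; ring]
    exact Nat.card_eq_one_iff_unique.2 ⟨this, ⟨0⟩⟩
  rw [h₁]
  simp

/-- Peeling off the first factor of the alternating product. -/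
lemma extAltProd_rec (hfin : Finitary T) (x y x' y' : T)
    (h₀ : Nat.card (x ⟶ y⟦(-1 : ℤ)⟧) = Nat.card (x' ⟶ y'))
    (h : ∀ i : ℕ, Nat.card (x ⟶ y⟦(-((i + 1 : ℕ) : ℤ) - 1)⟧) =
      Nat.card (x' ⟶ y'⟦(-(i : ℤ) - 1)⟧)) :
    extAltProd T x y * (Nat.card (x' ⟶ y') * extAltProd T x' y') = 1 := by
  obtain ⟨k, hk⟩ := hfin.exists_vanishesFrom x y
  let u : ℕ → ℚ := fun i => (Nat.card (x ⟶ y⟦(-(i : ℤ) - 1)⟧) : ℚ) ^ ((-1 : ℤ) ^ (i + 1))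
  let v : ℕ → ℚ := fun i => (Nat.card (x' ⟶ y'⟦(-(i : ℤ) - 1)⟧) : ℚ) ^ ((-1 : ℤ) ^ (i + 1))
  have hv : ∀ i, u (i + 1) = (v i)⁻¹ := fun i => by
    simp only [u, v]
    rw [h i, pow_succ, mul_neg_one, zpow_neg]
  have hu : ∀ i, k ≤ i → u i = 1 := fun i hi => by
    have := hk (i + 1) (by lia)
    rw [show (-((i + 1 : ℕ) : ℤ)) = (-(i : ℤ) - 1) by push_cast; ring] at this
    simp only [u]
    rw [Nat.card_eq_one_iff_unique.2 ⟨this, ⟨0⟩⟩]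
    simp
  have e₁ : extAltProd T x y = ∏ i ∈ Finset.range (k + 1), u i := by
    refine finprod_eq_prod_of_mulSupport_subset _ fun i hi => ?_
    by_contra hn
    exact hi (hu i (by simp at hn; lia))
  have e₂ : extAltProd T x' y' = ∏ i ∈ Finset.range k, v i := by
    refine finprod_eq_prod_of_mulSupport_subset _ fun i hi => ?_
    by_contra hn
    refine hi ?_
    have h₁ := hv i
    rw [hu (i + 1) (by simp at hn; lia)] at h₁
    exact (inv_eq_one.1 h₁.symm)
  have e₃ : u 0 = (Nat.card (x' ⟶ y') : ℚ)⁻¹ := by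
    have h₁ : Nat.card (x ⟶ y⟦(-((0 : ℕ) : ℤ) - 1)⟧) = Nat.card (x ⟶ y⟦(-1 : ℤ)⟧) := by simp
    simp only [u]
    rw [h₁, h₀]
    simp
  have hc : (Nat.card (x' ⟶ y') : ℚ) ≠ 0 := by exact_mod_cast (card_hom_pos _ _).ne'
  have hne := extAltProd_ne_zero x' y'
  rw [e₁, Finset.prod_range_succ', e₃, Finset.prod_congr rfl fun i _ => hv i,
    Finset.prod_inv_distrib, ← e₂]
  field_simp

lemma extAltProd_shift_left (hfin : Finitary T) (x y : T) :
    extAltProd T x y * (Nat.card (x⟦(1 : ℤ)⟧ ⟶ y) * extAltProd T (x⟦(1 : ℤ)⟧) y) = 1 := by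
  refine extAltProd_rec hfin x y _ _ ?_ fun i => ?_
  · exact Nat.card_congr ((shiftLeftEquiv x y (-1) 0 (by simp)).trans
      (Iso.homCongr (Iso.refl _) ((shiftFunctorZero T ℤ).app y)))
  · exact Nat.card_congr (shiftLeftEquiv x y _ _ (by push_cast; ring))

lemma extAltProd_shift_right (hfin : Finitary T) (x y : T) :
    extAltProd T x y * (Nat.card (x ⟶ y⟦(-1 : ℤ)⟧) * extAltProd T x (y⟦(-1 : ℤ)⟧)) = 1 :=
  extAltProd_rec hfin x y _ _ rfl fun i =>
    (Nat.card_congr (shiftRightEquiv x y (-1) _ _ (by push_cast; ring))).symm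

variable {x y z : T} {f : x ⟶ z} {g : z ⟶ y} {h : y ⟶ x⟦(1 : ℤ)⟧}

lemma extAltProd_post_of_vanishes (hfin : Finitary T) (H : Triangle.mk f g h ∈ distTriang T)
    (k : ℕ) : ∀ t : T, VanishesFrom k t x → VanishesFrom k t y → VanishesFrom k t z →
      extAltProd T t x * extAltProd T t y * kerPost t f = extAltProd T t z := by
  induction k with
  | zero =>
    intro t hx hy hz
    have := hx.subsingleton
    have h₁ : kerPost t f = 1 :=
      Nat.card_eq_one_iff_unique.2 ⟨inferInstance, ⟨⟨0, by simp⟩⟩⟩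
    rw [extAltProd_eq_one hx, extAltProd_eq_one hy, extAltProd_eq_one hz, h₁]
    simp
  | succ k ih =>
    intro t hx hy hz
    have hs := ih (t⟦(1 : ℤ)⟧) hx.shift_left hy.shift_left hz.shift_left
    have ex := extAltProd_shift_left hfin t x
    have ey := extAltProd_shift_left hfin t y
    have ez := extAltProd_shift_left hfin t z
    have h₀ : kerPost t f = rkPost (t⟦(1 : ℤ)⟧) h := by
      have c₁ := card_post_one H (t⟦(1 : ℤ)⟧)
      rw [card_hom_shift, rkPost_shift, card_eq_kerPost_mul_rkPost t f] at c₁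
      exact Nat.eq_of_mul_eq_mul_right (rkPost_pos _ _) c₁
    rw [card_eq_kerPost_mul_rkPost _ f] at ex
    rw [card_post_three H, ← h₀] at ey
    rw [card_post_two H] at ez
    have n₁ := extAltProd_ne_zero (t⟦(1 : ℤ)⟧) x
    have n₂ := extAltProd_ne_zero (t⟦(1 : ℤ)⟧) y
    have n₄ : (kerPost (t⟦(1 : ℤ)⟧) f : ℚ) ≠ 0 := by exact_mod_cast (kerPost_pos _ _).ne'
    have n₅ : (rkPost (t⟦(1 : ℤ)⟧) f : ℚ) ≠ 0 := by exact_mod_cast (rkPost_pos _ _).ne'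
    have n₆ : (rkPost (t⟦(1 : ℤ)⟧) g : ℚ) ≠ 0 := by exact_mod_cast (rkPost_pos _ _).ne'
    have n₇ : (kerPost t f : ℚ) ≠ 0 := by exact_mod_cast (kerPost_pos _ _).ne'
    rw [eq_inv_of_mul_eq_one_left ex, eq_inv_of_mul_eq_one_left ey,
      eq_inv_of_mul_eq_one_left ez, ← hs]
    push_cast
    field_simp

/-- Multiplicativity of the alternating product in its second argument. -/
lemma extAltProd_post (hfin : Finitary T) (H : Triangle.mk f g h ∈ distTriang T) (t : T) :
    extAltProd T t x * extAltProd T t y * kerPost t f = extAltProd T t z := by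
  obtain ⟨k₁, h₁⟩ := hfin.exists_vanishesFrom t x
  obtain ⟨k₂, h₂⟩ := hfin.exists_vanishesFrom t y
  obtain ⟨k₃, h₃⟩ := hfin.exists_vanishesFrom t z
  exact extAltProd_post_of_vanishes hfin H (k₁ + k₂ + k₃) t (h₁.mono (by lia))
    (h₂.mono (by lia)) (h₃.mono (by lia))

/-- The connecting exactness `Hom(x, t⟦-1⟧) → Hom(y, t) → Hom(z, t)` on the level of orders. -/
lemma kerPre_mul_rkPre_shift (H : Triangle.mk f g h ∈ distTriang T) (t : T) :
    kerPre g t * rkPre f (t⟦(-1 : ℤ)⟧) = Nat.card (x ⟶ t⟦(-1 : ℤ)⟧) := by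
  let e : ∀ a : T, (a ⟶ t⟦(-1 : ℤ)⟧) ≃ (a⟦(1 : ℤ)⟧ ⟶ t) := fun a =>
    (Functor.FullyFaithful.ofFullyFaithful (shiftFunctor T (1 : ℤ))).homEquiv.trans
      (Iso.homCongr (Iso.refl _) (shiftNegShift t (1 : ℤ)))
  have h₁ : rkPre f (t⟦(-1 : ℤ)⟧) = rkPre (f⟦(1 : ℤ)⟧') t := by
    have nat : ∀ v : z ⟶ t⟦(-1 : ℤ)⟧, e x (f ≫ v) = f⟦(1 : ℤ)⟧' ≫ e z v := fun v => by
      simp only [e, Functor.FullyFaithful.homEquiv,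
        Equiv.trans_apply, Equiv.coe_fn_mk, Iso.homCongr_apply, Iso.refl_inv, Category.id_comp,
        Functor.map_comp]
      exact Category.assoc _ _ _
    refine Nat.card_congr ((e x).subtypeEquiv fun u => ?_)
    constructor
    · rintro ⟨v, rfl⟩
      exact ⟨e z v, (nat v).symm⟩
    · rintro ⟨v, hv⟩
      obtain ⟨v, rfl⟩ := (e z).surjective v
      exact ⟨v, (e x).injective ((nat v).trans hv)⟩
  have h₂ : Nat.card (x ⟶ t⟦(-1 : ℤ)⟧) = Nat.card (x⟦(1 : ℤ)⟧ ⟶ t) := Nat.card_congr (e x)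
  rw [kerPre_eq_rkPre (rotate_mem H), h₁, h₂, card_pre_one H, mul_comm]

lemma extAltProd_pre_of_vanishes (hfin : Finitary T) (H : Triangle.mk f g h ∈ distTriang T)
    (k : ℕ) : ∀ t : T, VanishesFrom k x t → VanishesFrom k y t → VanishesFrom k z t →
      extAltProd T y t * extAltProd T x t * kerPre g t = extAltProd T z t := by
  induction k with
  | zero =>
    intro t hx hy hz
    have := hy.subsingleton
    have h₁ : kerPre g t = 1 :=
      Nat.card_eq_one_iff_unique.2 ⟨inferInstance, ⟨⟨0, by simp⟩⟩⟩
    rw [extAltProd_eq_one hx, extAltProd_eq_one hy, extAltProd_eq_one hz, h₁]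
    simp
  | succ k ih =>
    intro t hx hy hz
    have hs := ih (t⟦(-1 : ℤ)⟧) hx.shift_right hy.shift_right hz.shift_right
    have ex := extAltProd_shift_right hfin x t
    have ey := extAltProd_shift_right hfin y t
    have ez := extAltProd_shift_right hfin z t
    rw [← kerPre_mul_rkPre_shift H] at ex
    rw [card_eq_kerPre_mul_rkPre g] at ey
    rw [card_pre_two H] at ez
    have n₁ := extAltProd_ne_zero x (t⟦(-1 : ℤ)⟧)
    have n₂ := extAltProd_ne_zero y (t⟦(-1 : ℤ)⟧)
    have n₄ : (kerPre g (t⟦(-1 : ℤ)⟧) : ℚ) ≠ 0 := by exact_mod_cast (kerPre_pos _ _).ne'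
    have n₅ : (rkPre f (t⟦(-1 : ℤ)⟧) : ℚ) ≠ 0 := by exact_mod_cast (rkPre_pos _ _).ne'
    have n₆ : (rkPre g (t⟦(-1 : ℤ)⟧) : ℚ) ≠ 0 := by exact_mod_cast (rkPre_pos _ _).ne'
    have n₇ : (kerPre g t : ℚ) ≠ 0 := by exact_mod_cast (kerPre_pos _ _).ne'
    rw [eq_inv_of_mul_eq_one_left ex, eq_inv_of_mul_eq_one_left ey,
      eq_inv_of_mul_eq_one_left ez, ← hs]
    push_cast
    field_simp

/-- Multiplicativity of the alternating product in its first argument. -/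
lemma extAltProd_pre (hfin : Finitary T) (H : Triangle.mk f g h ∈ distTriang T) (t : T) :
    extAltProd T y t * extAltProd T x t * kerPre g t = extAltProd T z t := by
  obtain ⟨k₁, h₁⟩ := hfin.exists_vanishesFrom x t
  obtain ⟨k₂, h₂⟩ := hfin.exists_vanishesFrom y t
  obtain ⟨k₃, h₃⟩ := hfin.exists_vanishesFrom z t
  exact extAltProd_pre_of_vanishes hfin H (k₁ + k₂ + k₃) t (h₁.mono (by lia))
    (h₂.mono (by lia)) (h₃.mono (by lia))

end AltProd

section HallSets

variable {x y z : T}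

/-- The morphisms `z ⟶ y` whose cocone is isomorphic to `x`. -/
def coHallSet (x z y : T) : Set (z ⟶ y) :=
  {g | ∃ (x' : T) (f : x' ⟶ z) (h : y ⟶ x'⟦(1 : ℤ)⟧),
      (Triangle.mk f g h ∈ distTriang T) ∧ Nonempty (x' ≅ x)}

lemma mem_hallSet_iff (f : x ⟶ z) : f ∈ hallSet T x z y ↔
    ∃ (g : z ⟶ y) (h : y ⟶ x⟦(1 : ℤ)⟧), Triangle.mk f g h ∈ distTriang T := by
  constructor
  · rintro ⟨y', g, h, H, ⟨e⟩⟩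
    exact ⟨g ≫ e.hom, e.inv ≫ h, mem_of_iso H (Iso.refl _) (Iso.refl _) e (by simp) (by simp)
      (by simp)⟩
  · rintro ⟨g, h, H⟩
    exact ⟨y, g, h, H, ⟨Iso.refl _⟩⟩

lemma mem_coHallSet_iff (g : z ⟶ y) : g ∈ coHallSet x z y ↔
    ∃ (f : x ⟶ z) (h : y ⟶ x⟦(1 : ℤ)⟧), Triangle.mk f g h ∈ distTriang T := by
  constructor
  · rintro ⟨x', f, h, H, ⟨e⟩⟩
    exact ⟨e.inv ≫ f, h ≫ e.hom⟦(1 : ℤ)⟧', mem_of_iso H e (Iso.refl _) (Iso.refl _) (by simp)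
      (by simp) (by simp)⟩
  · rintro ⟨f, h, H⟩
    exact ⟨x, f, h, H, ⟨Iso.refl _⟩⟩

lemma mem_hallSet_iff_of_mem {w : T} {f : x ⟶ z} {g : z ⟶ w} {h : w ⟶ x⟦(1 : ℤ)⟧}
    (H : Triangle.mk f g h ∈ distTriang T) : f ∈ hallSet T x z y ↔ Nonempty (w ≅ y) := by
  constructor
  · rw [mem_hallSet_iff]
    rintro ⟨g', h', H'⟩
    obtain ⟨c, -⟩ := exists_third_iso H H' (Iso.refl _) (Iso.refl _) (by simp)
    exact ⟨c⟩
  · exact fun e => ⟨w, g, h, H, e⟩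

lemma mem_coHallSet_iff_of_mem {w : T} {f : w ⟶ z} {g : z ⟶ y} {h : y ⟶ w⟦(1 : ℤ)⟧}
    (H : Triangle.mk f g h ∈ distTriang T) : g ∈ coHallSet x z y ↔ Nonempty (w ≅ x) := by
  constructor
  · rw [mem_coHallSet_iff]
    rintro ⟨f', h', H'⟩
    obtain ⟨c, -⟩ := exists_first_iso H H' (Iso.refl _) (Iso.refl _) (by simp)
    exact ⟨c⟩
  · exact fun e => ⟨w, f, h, H, e⟩

lemma hallSet_congr {x' y' z' : T} (a : x ≅ x') (b : y ≅ y') (c : z ≅ z') :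
    Nat.card (hallSet T x z y) = Nat.card (hallSet T x' z' y') := by
  refine Nat.card_congr ((a.homCongr c).subtypeEquiv fun f => ?_)
  change f ∈ hallSet T x z y ↔ a.homCongr c f ∈ hallSet T x' z' y'
  rw [mem_hallSet_iff, mem_hallSet_iff]
  constructor
  · rintro ⟨g, h, H⟩
    exact ⟨c.inv ≫ g ≫ b.hom, b.inv ≫ h ≫ a.hom⟦(1 : ℤ)⟧', mem_of_iso H a c b (by simp) (by simp)
      (by simp)⟩
  · rintro ⟨g, h, H⟩
    exact ⟨c.hom ≫ g ≫ b.inv, b.hom ≫ h ≫ a.inv⟦(1 : ℤ)⟧', mem_of_iso H a.symm c.symm b.symm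
      (by simp) (by simp) (by simp)⟩

variable [∀ x y : T, Finite (x ⟶ y)]

lemma hallNumber_congr {x' y' z' : T} (a : x ≅ x') (b : y ≅ y') (c : z ≅ z') :
    hallNumber T x y z = hallNumber T x' y' z' := by
  unfold hallNumber
  rw [hallSet_congr a b c, extAltProd_congr a c, extAltProd_congr a a,
    Nat.card_congr a.conjAut.toEquiv]

instance finite_iso (x y : T) : Finite (x ≅ y) :=
  Finite.of_injective (fun e : x ≅ y => e.hom) fun _ _ h => Iso.ext h

instance finite_aut (x : T) : Finite (Aut x) := finite_iso x x

lemma card_aut_ne_zero (x : T) : (Nat.card (Aut x) : ℚ) ≠ 0 := by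
  exact_mod_cast Nat.card_pos.ne'

variable {f : x ⟶ z} {g : z ⟶ y} {h : y ⟶ x⟦(1 : ℤ)⟧}

lemma card_aut_third {g₀ : z ⟶ y} {h₀ : y ⟶ x⟦(1 : ℤ)⟧}
    (H₀ : Triangle.mk f g₀ h₀ ∈ distTriang T) (H : Triangle.mk f g h ∈ distTriang T) :
    Nat.card {c : y ≅ y // g₀ ≫ c.hom = g ∧ c.hom ≫ h = h₀} =
      Nat.card {c : y ⟶ y // g ≫ c = 0 ∧ c ≫ h = 0} := by
  obtain ⟨c₀, hc₁, hc₂⟩ := exists_third_iso H₀ H (Iso.refl _) (Iso.refl _) (by simp)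
  replace hc₁ : g₀ ≫ c₀.hom = g := by simpa using hc₁
  replace hc₂ : h₀ = c₀.hom ≫ h := by simpa using hc₂
  have e₁ : g ≫ c₀.inv = g₀ := by simp [← hc₁]
  have e₂ : c₀.inv ≫ h₀ = h := by simp [hc₂]
  refine Nat.card_congr (Equiv.ofBijective (fun c => ⟨c₀.inv ≫ c.1.hom - 𝟙 y, ?_, ?_⟩) ⟨?_, ?_⟩)
  · simp [Preadditive.comp_sub, reassoc_of% e₁, c.2.1]
  · simp [Preadditive.sub_comp, c.2.2, e₂]
  · rintro ⟨c, hc⟩ ⟨c', hc'⟩ heq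
    have h₁ : c₀.inv ≫ c.hom - 𝟙 y = c₀.inv ≫ c'.hom - 𝟙 y := congrArg Subtype.val heq
    exact Subtype.ext (Iso.ext (by simpa using h₁))
  · rintro ⟨b, hb₁, hb₂⟩
    have h₁ : g ≫ (𝟙 y + b) = 𝟙 z ≫ g := by simp [Preadditive.comp_add, hb₁]
    have h₂ : h ≫ (𝟙 x)⟦(1 : ℤ)⟧' = (𝟙 y + b) ≫ h := by simp [Preadditive.add_comp, hb₂]
    have : IsIso (𝟙 y + b) := isIso₃_of_isIso₁₂
      (Triangle.homMk (Triangle.mk f g h) (Triangle.mk f g h) (𝟙 x) (𝟙 z) (𝟙 y + b)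
        ((Category.comp_id _).trans (Category.id_comp _).symm) h₁ h₂) H H
      (inferInstanceAs (IsIso (𝟙 x))) (inferInstanceAs (IsIso (𝟙 z)))
    refine ⟨⟨c₀ ≪≫ asIso (𝟙 y + b), ?_, ?_⟩, Subtype.ext ?_⟩
    · simp [hc₁, reassoc_of% hc₁, Preadditive.comp_add, hb₁]
    · simp [Preadditive.add_comp, hb₂, ← hc₂]
    · simp

lemma card_aut_first {f₀ : x ⟶ z} {h₀ : y ⟶ x⟦(1 : ℤ)⟧}
    (H₀ : Triangle.mk f₀ g h₀ ∈ distTriang T) (H : Triangle.mk f g h ∈ distTriang T) :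
    Nat.card {c : x ≅ x // c.hom ≫ f = f₀ ∧ h₀ ≫ c.hom⟦(1 : ℤ)⟧' = h} =
      Nat.card {c : x ⟶ x // c ≫ f = 0 ∧ h ≫ c⟦(1 : ℤ)⟧' = 0} := by
  obtain ⟨c₀, hc₁, hc₂⟩ := exists_first_iso H₀ H (Iso.refl _) (Iso.refl _) (by simp)
  simp only [Iso.refl_hom, Category.id_comp, Category.comp_id] at hc₁ hc₂
  have e₂ : h ≫ c₀.inv⟦(1 : ℤ)⟧' = h₀ := by simp [← hc₂]
  refine Nat.card_congr (Equiv.ofBijective (fun c => ⟨c₀.inv ≫ c.1.hom - 𝟙 x, ?_, ?_⟩) ⟨?_, ?_⟩)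
  · simp [Preadditive.sub_comp, c.2.1, hc₁]
  · rw [Functor.map_sub, Functor.map_comp, Preadditive.comp_sub, reassoc_of% e₂, c.2.2]
    simp
  · rintro ⟨c, hc⟩ ⟨c', hc'⟩ heq
    have h₁ : c₀.inv ≫ c.hom - 𝟙 x = c₀.inv ≫ c'.hom - 𝟙 x := congrArg Subtype.val heq
    exact Subtype.ext (Iso.ext (by simpa using h₁))
  · rintro ⟨b, hb₁, hb₂⟩
    have h₁ : f ≫ 𝟙 z = (𝟙 x + b) ≫ f := by simp [Preadditive.add_comp, hb₁]
    have h₂ : h ≫ (𝟙 x + b)⟦(1 : ℤ)⟧' = 𝟙 y ≫ h := by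
      rw [Functor.map_add, Preadditive.comp_add, hb₂]
      simp
    have : IsIso (𝟙 x + b) := isIso₁_of_isIso₂₃
      (Triangle.homMk (Triangle.mk f g h) (Triangle.mk f g h) (𝟙 x + b) (𝟙 z) (𝟙 y)
        h₁ ((Category.comp_id _).trans (Category.id_comp _).symm) h₂) H H
      (inferInstanceAs (IsIso (𝟙 z))) (inferInstanceAs (IsIso (𝟙 y)))
    refine ⟨⟨c₀ ≪≫ asIso (𝟙 x + b), ?_, ?_⟩, Subtype.ext ?_⟩
    · simp [Preadditive.add_comp, hb₁, hc₁]
    · simp only [Iso.trans_hom, asIso_hom, Functor.map_comp, reassoc_of% hc₂, h₂,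
        Category.id_comp]
    · simp

/-- The distinguished triangles on three given objects. -/
abbrev DistTriangles (x z y : T) :=
  {t : (x ⟶ z) × (z ⟶ y) × (y ⟶ x⟦(1 : ℤ)⟧) // Triangle.mk t.1 t.2.1 t.2.2 ∈ distTriang T}

noncomputable instance fintype_distTriangles (x z y : T) : Fintype (DistTriangles x z y) :=
  Fintype.ofFinite _

lemma card_hallSet_mul_card_aut (x z y : T) :
    Nat.card (hallSet T x z y) * Nat.card (Aut y) = ∑ t : DistTriangles x z y,
      Nat.card {c : y ⟶ y // t.1.2.1 ≫ c = 0 ∧ c ≫ t.1.2.2 = 0} := by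
  choose g₀ h₀ H₀ using fun f : hallSet T x z y => (mem_hallSet_iff f.1).1 f.2
  let Φ : hallSet T x z y × (y ≅ y) → DistTriangles x z y := fun p =>
    ⟨(p.1.1, g₀ p.1 ≫ p.2.hom, p.2.inv ≫ h₀ p.1),
      mem_of_iso (H₀ p.1) (Iso.refl _) (Iso.refl _) p.2 (by simp) (by simp) (by simp)⟩
  change _ * Nat.card (y ≅ y) = _
  rw [← Nat.card_prod, card_eq_sum_card_fiber Φ]
  refine Finset.sum_congr rfl fun t _ => ?_
  obtain ⟨⟨f, g, h⟩, H⟩ := t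
  let f' : hallSet T x z y := ⟨f, (mem_hallSet_iff f).2 ⟨g, h, H⟩⟩
  rw [← card_aut_third (H₀ f') H]
  refine Nat.card_congr
    { toFun := fun p => ⟨p.1.2, ?_⟩
      invFun := fun c => ⟨(f', c.1), ?_⟩
      left_inv := fun p => ?_
      right_inv := fun c => rfl }
  · obtain ⟨⟨f₁, c⟩, hp⟩ := p
    simp only [Φ, Subtype.mk.injEq, Prod.mk.injEq] at hp
    obtain ⟨hf, hg, hh⟩ := hp
    obtain rfl : f₁ = f' := Subtype.ext hf
    exact ⟨hg, ((Iso.inv_comp_eq c).1 hh).symm⟩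
  · simp only [Φ, Subtype.mk.injEq, Prod.mk.injEq]
    exact ⟨rfl, c.2.1, (Iso.inv_comp_eq c.1).2 c.2.2.symm⟩
  · obtain ⟨⟨f₁, c⟩, hp⟩ := p
    simp only [Φ, Subtype.mk.injEq, Prod.mk.injEq] at hp
    exact Subtype.ext (Prod.ext (Subtype.ext hp.1.symm) rfl)

lemma card_coHallSet_mul_card_aut (x z y : T) :
    Nat.card (coHallSet x z y) * Nat.card (Aut x) = ∑ t : DistTriangles x z y,
      Nat.card {c : x ⟶ x // c ≫ t.1.1 = 0 ∧ t.1.2.2 ≫ c⟦(1 : ℤ)⟧' = 0} := by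
  choose f₀ h₀ H₀ using fun g : coHallSet x z y => (mem_coHallSet_iff g.1).1 g.2
  let Φ : coHallSet x z y × (x ≅ x) → DistTriangles x z y := fun p =>
    ⟨(p.2.inv ≫ f₀ p.1, p.1.1, h₀ p.1 ≫ p.2.hom⟦(1 : ℤ)⟧'),
      mem_of_iso (H₀ p.1) p.2 (Iso.refl _) (Iso.refl _) (by simp) (by simp) (by simp)⟩
  change _ * Nat.card (x ≅ x) = _
  rw [← Nat.card_prod, card_eq_sum_card_fiber Φ]
  refine Finset.sum_congr rfl fun t _ => ?_
  obtain ⟨⟨f, g, h⟩, H⟩ := t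
  let g' : coHallSet x z y := ⟨g, (mem_coHallSet_iff g).2 ⟨f, h, H⟩⟩
  rw [← card_aut_first (H₀ g') H]
  refine Nat.card_congr
    { toFun := fun p => ⟨p.1.2, ?_⟩
      invFun := fun c => ⟨(g', c.1), ?_⟩
      left_inv := fun p => ?_
      right_inv := fun c => rfl }
  · obtain ⟨⟨g₁, c⟩, hp⟩ := p
    simp only [Φ, Subtype.mk.injEq, Prod.mk.injEq] at hp
    obtain ⟨hf, hg, hh⟩ := hp
    obtain rfl : g₁ = g' := Subtype.ext hg
    exact ⟨((Iso.inv_comp_eq c).1 hf).symm, hh⟩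
  · simp only [Φ, Subtype.mk.injEq, Prod.mk.injEq]
    exact ⟨(Iso.inv_comp_eq c.1).2 c.2.1.symm, rfl, c.2.2⟩
  · obtain ⟨⟨g₁, c⟩, hp⟩ := p
    simp only [Φ, Subtype.mk.injEq, Prod.mk.injEq] at hp
    exact Subtype.ext (Prod.ext (Subtype.ext hp.2.1.symm) rfl)

/-- Comparison of the stabilizers of a triangle in the automorphism groups of its outer terms. -/
lemma card_stabilizer_mul (H : Triangle.mk f g h ∈ distTriang T) :
    Nat.card {c : y ⟶ y // g ≫ c = 0 ∧ c ≫ h = 0} * kerPost x f =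
      Nat.card {c : x ⟶ x // c ≫ f = 0 ∧ h ≫ c⟦(1 : ℤ)⟧' = 0} * kerPre g y := by
  have h₁ : kerPost x f = Nat.card {c : x ⟶ x // c ≫ f = 0 ∧ h ≫ c⟦(1 : ℤ)⟧' = 0} *
      Nat.card {d : y ⟶ x⟦(1 : ℤ)⟧ // ∃ c : x ⟶ x, c ≫ f = 0 ∧ h ≫ c⟦(1 : ℤ)⟧' = d} :=
    card_ker_eq_mul (Preadditive.rightComp x f)
      ((Preadditive.leftComp _ h).comp (shiftFunctor T (1 : ℤ)).mapAddHom)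
  have h₂ : kerPre g y = Nat.card {c : y ⟶ y // g ≫ c = 0 ∧ c ≫ h = 0} *
      Nat.card {d : y ⟶ x⟦(1 : ℤ)⟧ // ∃ c : y ⟶ y, g ≫ c = 0 ∧ c ≫ h = d} :=
    card_ker_eq_mul (Preadditive.leftComp y g) (Preadditive.rightComp y h)
  have h₃ : ∀ d : y ⟶ x⟦(1 : ℤ)⟧, (∃ c : x ⟶ x, c ≫ f = 0 ∧ h ≫ c⟦(1 : ℤ)⟧' = d) ↔
      ∃ c : y ⟶ y, g ≫ c = 0 ∧ c ≫ h = d := fun d => by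
    constructor
    · rintro ⟨c, hc, rfl⟩
      obtain ⟨b, hb₁, hb₂⟩ := exists_third H H c 0 (by simp [hc])
      exact ⟨b, by simpa using hb₁, hb₂.symm⟩
    · rintro ⟨c, hc, rfl⟩
      obtain ⟨b, hb₁, hb₂⟩ := exists_first H H 0 c (by simp [hc])
      exact ⟨b, by simpa using hb₁.symm, hb₂⟩
  rw [h₁, h₂, Nat.card_congr (Equiv.subtypeEquivRight h₃)]
  ring

/-- The derived Hall number expressed through morphisms onto the quotient. -/
lemma hallNumber_eq_coHall (hfin : Finitary T) (x y z : T) :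
    hallNumber T x y z = (Nat.card (coHallSet x z y) * extAltProd T z y) /
      (Nat.card (Aut y) * extAltProd T y y) := by
  have h₁ := congrArg (fun n : ℕ => (n : ℚ)) (card_hallSet_mul_card_aut x z y)
  have h₂ := congrArg (fun n : ℕ => (n : ℚ)) (card_coHallSet_mul_card_aut x z y)
  push_cast at h₁ h₂
  have key : (Nat.card (hallSet T x z y) * Nat.card (Aut y) : ℚ) *
      (extAltProd T x z * extAltProd T y y) =
      (Nat.card (coHallSet x z y) * Nat.card (Aut x)) *
        (extAltProd T z y * extAltProd T x x) := by
    rw [h₁, h₂, Finset.sum_mul, Finset.sum_mul]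
    refine Finset.sum_congr rfl fun t _ => ?_
    have s := congrArg (fun n : ℕ => (n : ℚ)) (card_stabilizer_mul t.2)
    push_cast at s
    rw [← extAltProd_post hfin t.2 x, ← extAltProd_pre hfin t.2 y]
    linear_combination (extAltProd T x x * extAltProd T x y * extAltProd T y y) * s
  have n₁ := extAltProd_ne_zero x x
  have n₂ := extAltProd_ne_zero y y
  have n₃ := card_aut_ne_zero x
  have n₄ := card_aut_ne_zero y
  rw [hallNumber, div_eq_div_iff (mul_ne_zero n₃ n₁) (mul_ne_zero n₄ n₂)]
  linear_combination key

end HallSets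

section Associativity

variable [∀ x y : T, Finite (x ⟶ y)]

section Lifts

variable {x m z w w' : T} {f : x ⟶ m} {j : m ⟶ w'} {d : w' ⟶ x⟦(1 : ℤ)⟧}
  {i : w ⟶ m} {g : m ⟶ z} {d' : z ⟶ w⟦(1 : ℤ)⟧}

lemma card_lift (l₀ : x ⟶ w) (hl₀ : l₀ ≫ i = f) : Nat.card {l : x ⟶ w // l ≫ i = f} =
    kerPost x i :=
  card_eq_of_torsor l₀ fun a => by simp [Preadditive.add_comp, hl₀]

lemma card_desc (g₀ : w' ⟶ z) (hg₀ : j ≫ g₀ = g) : Nat.card {g' : w' ⟶ z // j ≫ g' = g} =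
    kerPre j z :=
  card_eq_of_torsor g₀ fun a => by simp [Preadditive.comp_add, hg₀]

lemma card_desc_compatible (A : Triangle.mk f j d ∈ distTriang T)
    (B : Triangle.mk i g d' ∈ distTriang T) (l : x ⟶ w) (hl : l ≫ i = f) :
    Nat.card {g' : w' ⟶ z // j ≫ g' = g ∧ d ≫ l⟦(1 : ℤ)⟧' = g' ≫ d'} =
      Nat.card {b : w' ⟶ z // j ≫ b = 0 ∧ b ≫ d' = 0} := by
  obtain ⟨c, hc₁, hc₂⟩ := exists_third A B l (𝟙 m) (by simp [hl])
  rw [Category.id_comp] at hc₁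
  exact card_eq_of_torsor c fun a => by simp [Preadditive.add_comp, Preadditive.comp_add, hc₁, hc₂]

lemma card_lift_compatible (A : Triangle.mk f j d ∈ distTriang T)
    (B : Triangle.mk i g d' ∈ distTriang T) (g' : w' ⟶ z) (hg : j ≫ g' = g) :
    Nat.card {l : x ⟶ w // l ≫ i = f ∧ d ≫ l⟦(1 : ℤ)⟧' = g' ≫ d'} =
      Nat.card {a : x ⟶ w // a ≫ i = 0 ∧ d ≫ a⟦(1 : ℤ)⟧' = 0} := by
  obtain ⟨c, hc₁, hc₂⟩ := exists_first A B (𝟙 m) g' (by simp [hg])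
  rw [Category.comp_id] at hc₁
  exact card_eq_of_torsor c fun a => by
    simp [Preadditive.add_comp, Preadditive.comp_add, hc₁.symm, hc₂]

/-- Comparison of the lifts of `f` with a given cone and the descents of `g` with the same
cocone. -/
lemma card_lift_mul_kerPre (hfin : Finitary T) (A : Triangle.mk f j d ∈ distTriang T)
    (B : Triangle.mk i g d' ∈ distTriang T) (y : T) :
    Nat.card {l : x ⟶ w // l ≫ i = f ∧ l ∈ hallSet T x w y} * kerPre j z =
      Nat.card {g' : w' ⟶ z // j ≫ g' = g ∧ g' ∈ coHallSet y w' z} * kerPost x i := by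
  by_cases hfg : f ≫ g = 0
  · obtain ⟨l₀, hl₀⟩ := post_exact B hfg
    obtain ⟨g₀, hg₀⟩ := pre_exact A hfg
    have h₁ := card_mul_eq_card_mul_of_relation (Y := fun _ => True) (Z := fun _ => True)
      (card_desc_compatible A B) (card_lift_compatible A B) (by simp)
    have h₂ := card_mul_eq_card_mul_of_relation (Y := fun l => l ∈ hallSet T x w y)
      (Z := fun g' => g' ∈ coHallSet y w' z)
      (card_desc_compatible A B) (card_lift_compatible A B) (fun l g' hl hg hlg => by
        obtain ⟨c, p, q, C⟩ := exists_cone l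
        obtain ⟨c', a, b, D⟩ := exists_cocone g'
        obtain ⟨e⟩ := nonempty_iso_of_morphism hfin A B hl hg hlg C D
        rw [mem_hallSet_iff_of_mem C, mem_coHallSet_iff_of_mem D]
        exact ⟨fun ⟨e'⟩ => ⟨e.symm ≪≫ e'⟩, fun ⟨e'⟩ => ⟨e ≪≫ e'⟩⟩)
    simp only [and_true] at h₁
    rw [card_lift l₀ hl₀.symm, card_desc g₀ hg₀.symm] at h₁
    have hpos : 0 < Nat.card {b : w' ⟶ z // j ≫ b = 0 ∧ b ≫ d' = 0} :=
      have : Nonempty {b : w' ⟶ z // j ≫ b = 0 ∧ b ≫ d' = 0} := ⟨⟨0, by simp, by simp⟩⟩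
      Nat.card_pos
    refine Nat.eq_of_mul_eq_mul_right hpos ?_
    linear_combination kerPre j z * h₂ -
      Nat.card {g' : w' ⟶ z // j ≫ g' = g ∧ g' ∈ coHallSet y w' z} * h₁
  · have h₁ : IsEmpty {l : x ⟶ w // l ≫ i = f ∧ l ∈ hallSet T x w y} :=
      ⟨fun l => hfg (by rw [← l.2.1, Category.assoc, comp_fg B, comp_zero])⟩
    have h₂ : IsEmpty {g' : w' ⟶ z // j ≫ g' = g ∧ g' ∈ coHallSet y w' z} :=
      ⟨fun l => hfg (by rw [← l.2.1, ← Category.assoc, comp_fg A, zero_comp])⟩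
    simp

end Lifts

lemma cls_eq_iff {x y : T} : cls T x = cls T y ↔ Nonempty (x ≅ y) := Quotient.eq

lemma cls_out (a : IsoClass T) : cls T a.out = a := Quotient.out_eq a

lemma hallNumberQ_cls (x y z : T) :
    hallNumberQ T (cls T x) (cls T y) (cls T z) = hallNumber T x y z := by
  obtain ⟨a⟩ := cls_eq_iff.1 (cls_out (cls T x))
  obtain ⟨b⟩ := cls_eq_iff.1 (cls_out (cls T y))
  obtain ⟨c⟩ := cls_eq_iff.1 (cls_out (cls T z))
  exact hallNumber_congr a b c

lemma finite_support_hallNumberQ (a b : IsoClass T) :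
    (Function.support fun c => hallNumberQ T a b c).Finite := by
  choose z f g H using fun h : b.out ⟶ a.out⟦(1 : ℤ)⟧ => distinguished_cocone_triangle₂ h
  refine (Set.finite_range fun h => cls T (z h)).subset fun c hc => ?_
  have hne : Nonempty (hallSet T a.out c.out b.out) := by
    by_contra hn
    rw [not_nonempty_iff] at hn
    exact hc (by simp [hallNumberQ, hallNumber])
  obtain ⟨u, hu⟩ := hne
  obtain ⟨v, h, H'⟩ := (mem_hallSet_iff u).1 hu
  obtain ⟨e⟩ := exists_second_iso (H h) H' (Iso.refl _) (Iso.refl _) (by simp)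
  exact ⟨h, (cls_eq_iff.2 ⟨e⟩).trans (cls_out c)⟩

/-- The left-hand side of associativity as a sum over pairs of morphisms. -/
lemma finsum_hallNumber_left (hfin : Finitary T) (x y z m : T) (w : (m ⟶ z) → T)
    (i : ∀ g, w g ⟶ m) (d' : ∀ g, z ⟶ (w g)⟦(1 : ℤ)⟧)
    (B : ∀ g, Triangle.mk (i g) g (d' g) ∈ distTriang T) [Fintype (m ⟶ z)] [Fintype (x ⟶ m)] :
    ∑ᶠ c : IsoClass T, hallNumber T x y c.out * hallNumber T c.out z m =
      (∑ g : m ⟶ z, ∑ f : x ⟶ m,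
        (Nat.card {l : x ⟶ w g // l ≫ i g = f ∧ l ∈ hallSet T x (w g) y} : ℚ) /
          kerPost x (i g)) * (extAltProd T x m * extAltProd T m z) /
        (Nat.card (Aut x) * extAltProd T x x * extAltProd T x z *
          (Nat.card (Aut z) * extAltProd T z z)) := by
  have h₁ : ∀ c : IsoClass T, hallNumber T x y c.out * hallNumber T c.out z m =
      (hallNumber T x y c.out * (extAltProd T m z / (Nat.card (Aut z) * extAltProd T z z))) *
        (Nat.card {g // cls T (w g) = c} : ℚ) := fun c => by
    have e : Nat.card (coHallSet c.out m z) = Nat.card {g // cls T (w g) = c} :=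
      Nat.card_congr (Equiv.subtypeEquivRight fun g => by
        rw [mem_coHallSet_iff_of_mem (B g), ← cls_eq_iff, cls_out])
    rw [hallNumber_eq_coHall hfin c.out z m, e]
    ring
  rw [finsum_congr h₁, finsum_mul_card_fiber (fun g => cls T (w g)), Finset.sum_mul,
    Finset.sum_div]
  refine Finset.sum_congr rfl fun g _ => ?_
  obtain ⟨e⟩ := cls_eq_iff.1 (cls_out (cls T (w g)))
  have h₂ : Nat.card (hallSet T x (w g) y) = ∑ f : x ⟶ m,
      Nat.card {l : x ⟶ w g // l ≫ i g = f ∧ l ∈ hallSet T x (w g) y} := by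
    rw [card_eq_sum_card_fiber fun l : hallSet T x (w g) y => l.1 ≫ i g]
    refine Finset.sum_congr rfl fun f _ => ?_
    exact Nat.card_congr ((Equiv.subtypeSubtypeEquivSubtypeInter
      (fun l => l ∈ hallSet T x (w g) y) (fun l => l ≫ i g = f)).trans
        (Equiv.subtypeEquivRight fun l => and_comm))
  have n₁ := extAltProd_ne_zero x x
  have n₂ := extAltProd_ne_zero x z
  have n₃ := extAltProd_ne_zero z z
  have n₄ := card_aut_ne_zero x
  have n₅ := card_aut_ne_zero z
  have n₆ : (kerPost x (i g) : ℚ) ≠ 0 := by exact_mod_cast (kerPost_pos x (i g)).ne'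
  rw [hallNumber_congr (Iso.refl x) (Iso.refl y) e, hallNumber, h₂, ← Finset.sum_div,
    ← extAltProd_post hfin (B g) x]
  push_cast
  field_simp

/-- The right-hand side of associativity as a sum over pairs of morphisms. -/
lemma finsum_hallNumber_right (hfin : Finitary T) (x y z m : T) (w' : (x ⟶ m) → T)
    (j : ∀ f, m ⟶ w' f) (d : ∀ f, w' f ⟶ x⟦(1 : ℤ)⟧)
    (A : ∀ f, Triangle.mk f (j f) (d f) ∈ distTriang T) [Fintype (m ⟶ z)] [Fintype (x ⟶ m)] :
    ∑ᶠ c : IsoClass T, hallNumber T y z c.out * hallNumber T x c.out m =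
      (∑ f : x ⟶ m, ∑ g : m ⟶ z,
        (Nat.card {g' : w' f ⟶ z // j f ≫ g' = g ∧ g' ∈ coHallSet y (w' f) z} : ℚ) /
          kerPre (j f) z) * (extAltProd T x m * extAltProd T m z) /
        (Nat.card (Aut x) * extAltProd T x x * extAltProd T x z *
          (Nat.card (Aut z) * extAltProd T z z)) := by
  have h₁ : ∀ c : IsoClass T, hallNumber T y z c.out * hallNumber T x c.out m =
      (hallNumber T y z c.out * (extAltProd T x m / (Nat.card (Aut x) * extAltProd T x x))) *
        (Nat.card {f // cls T (w' f) = c} : ℚ) := fun c => by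
    have e : Nat.card (hallSet T x m c.out) = Nat.card {f // cls T (w' f) = c} :=
      Nat.card_congr (Equiv.subtypeEquivRight fun f => by
        rw [mem_hallSet_iff_of_mem (A f), ← cls_eq_iff, cls_out])
    rw [hallNumber.eq_1 T x, e]
    ring
  rw [finsum_congr h₁, finsum_mul_card_fiber (fun f => cls T (w' f)), Finset.sum_mul,
    Finset.sum_div]
  refine Finset.sum_congr rfl fun f _ => ?_
  obtain ⟨e⟩ := cls_eq_iff.1 (cls_out (cls T (w' f)))
  have h₂ : Nat.card (coHallSet y (w' f) z) = ∑ g : m ⟶ z,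
      Nat.card {g' : w' f ⟶ z // j f ≫ g' = g ∧ g' ∈ coHallSet y (w' f) z} := by
    rw [card_eq_sum_card_fiber fun g' : coHallSet y (w' f) z => j f ≫ g'.1]
    refine Finset.sum_congr rfl fun g _ => ?_
    exact Nat.card_congr ((Equiv.subtypeSubtypeEquivSubtypeInter
      (fun g' => g' ∈ coHallSet y (w' f) z) (fun g' => j f ≫ g' = g)).trans
        (Equiv.subtypeEquivRight fun l => and_comm))
  have n₁ := extAltProd_ne_zero x x
  have n₂ := extAltProd_ne_zero x z
  have n₃ := extAltProd_ne_zero z z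
  have n₄ := card_aut_ne_zero x
  have n₅ := card_aut_ne_zero z
  have n₆ : (kerPre (j f) z : ℚ) ≠ 0 := by exact_mod_cast (kerPre_pos (j f) z).ne'
  rw [hallNumber_congr (Iso.refl y) (Iso.refl z) e, hallNumber_eq_coHall hfin, h₂,
    ← Finset.sum_div, ← extAltProd_pre hfin (A f) z]
  push_cast
  field_simp

lemma finsum_hallNumber_assoc (hfin : Finitary T) (x y z m : T) :
    ∑ᶠ c : IsoClass T, hallNumber T x y c.out * hallNumber T c.out z m =
      ∑ᶠ c : IsoClass T, hallNumber T y z c.out * hallNumber T x c.out m := by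
  have := Fintype.ofFinite (m ⟶ z)
  have := Fintype.ofFinite (x ⟶ m)
  choose w i d' B using fun g : m ⟶ z => exists_cocone g
  choose w' j d A using fun f : x ⟶ m => exists_cone f
  rw [finsum_hallNumber_left hfin x y z m w i d' B, finsum_hallNumber_right hfin x y z m w' j d A,
    Finset.sum_comm]
  congr 2
  refine Finset.sum_congr rfl fun f _ => Finset.sum_congr rfl fun g _ => ?_
  have n₁ : (kerPost x (i g) : ℚ) ≠ 0 := by exact_mod_cast (kerPost_pos x (i g)).ne'
  have n₂ : (kerPre (j f) z : ℚ) ≠ 0 := by exact_mod_cast (kerPre_pos (j f) z).ne'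
  rw [div_eq_div_iff n₁ n₂]
  exact_mod_cast card_lift_mul_kerPre hfin (A f) (B g) y

end Associativity

section Units

open ZeroObject

variable [∀ x y : T, Finite (x ⟶ y)]

lemma mem_hallSet_zero_left (y z : T) (f : (0 : T) ⟶ z) :
    f ∈ hallSet T 0 z y ↔ Nonempty (z ≅ y) := by
  obtain rfl : f = 0 := (isZero_zero T).eq_of_src _ _
  exact mem_hallSet_iff_of_mem (contractible_distinguished₁ z)

lemma mem_hallSet_zero_right (x z : T) (f : x ⟶ z) : f ∈ hallSet T x z 0 ↔ IsIso f := by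
  constructor
  · rw [mem_hallSet_iff]
    rintro ⟨g, h, H⟩
    exact (Triangle.isZero₃_iff_isIso₁ _ H).1 (isZero_zero T)
  · intro hf
    obtain ⟨c, g, h, H⟩ := exists_cone f
    rw [mem_hallSet_iff_of_mem H]
    exact ⟨((Triangle.isZero₃_iff_isIso₁ _ H).2 hf).iso (isZero_zero T)⟩

lemma extAltProd_zero_left (z : T) : extAltProd T 0 z = 1 :=
  extAltProd_eq_one fun _ _ => ⟨fun _ _ => (isZero_zero T).eq_of_src _ _⟩

lemma hallNumber_zero_left_of_iso {y z : T} (e : z ≅ y) : hallNumber T 0 y z = 1 := by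
  have h₁ : Nat.card (hallSet T 0 z y) = 1 :=
    Nat.card_eq_one_iff_unique.2 ⟨⟨fun _ _ => Subtype.ext ((isZero_zero T).eq_of_src _ _)⟩,
      ⟨0, (mem_hallSet_zero_left y z 0).2 ⟨e⟩⟩⟩
  have h₂ : Nat.card (Aut (0 : T)) = 1 :=
    Nat.card_eq_one_iff_unique.2 ⟨⟨fun _ _ => Iso.ext ((isZero_zero T).eq_of_src _ _)⟩, ⟨1⟩⟩
  simp [hallNumber, h₁, h₂, extAltProd_zero_left]

lemma hallNumber_zero_left_of_not {y z : T} (e : ¬ Nonempty (z ≅ y)) :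
    hallNumber T 0 y z = 0 := by
  have : IsEmpty (hallSet T 0 z y) := ⟨fun f => e ((mem_hallSet_zero_left y z f.1).1 f.2)⟩
  simp [hallNumber]

lemma hallNumber_zero_right_of_iso {x z : T} (e : z ≅ x) : hallNumber T x 0 z = 1 := by
  rw [hallNumber_congr (Iso.refl x) (Iso.refl 0) e]
  have h : Nat.card (hallSet T x x 0) = Nat.card (Aut x) :=
    Nat.card_congr
      { toFun := fun f => have := (mem_hallSet_zero_right x x f.1).1 f.2; asIso f.1
        invFun := fun c => ⟨c.hom, (mem_hallSet_zero_right x x c.hom).2 (Iso.isIso_hom c)⟩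
        left_inv := fun _ => rfl
        right_inv := fun _ => Iso.ext rfl }
  rw [hallNumber, h, div_self (mul_ne_zero (card_aut_ne_zero x) (extAltProd_ne_zero x x))]

lemma hallNumber_zero_right_of_not {x z : T} (e : ¬ Nonempty (z ≅ x)) :
    hallNumber T x 0 z = 0 := by
  have : IsEmpty (hallSet T x z 0) := ⟨fun f =>
    have := (mem_hallSet_zero_right x z f.1).1 f.2
    e ⟨(asIso f.1).symm⟩⟩
  simp [hallNumber]

lemma hallNumberQ_zero_left (a c : IsoClass T) :
    hallNumberQ T (cls T 0) a c = (Finsupp.single a 1 : DH T) c := by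
  induction a using Quotient.inductionOn with | h y => ?_
  induction c using Quotient.inductionOn with | h z => ?_
  refine (hallNumberQ_cls 0 y z).trans ?_
  by_cases e : Nonempty (z ≅ y)
  · rw [show (Quotient.mk _ z : IsoClass T) = Quotient.mk _ y from cls_eq_iff.2 e,
      Finsupp.single_eq_same]
    exact hallNumber_zero_left_of_iso e.some
  · exact (hallNumber_zero_left_of_not e).trans
      (Finsupp.single_eq_of_ne fun h => e (cls_eq_iff.1 h)).symm

lemma hallNumberQ_zero_right (a c : IsoClass T) :
    hallNumberQ T a (cls T 0) c = (Finsupp.single a 1 : DH T) c := by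
  induction a using Quotient.inductionOn with | h x => ?_
  induction c using Quotient.inductionOn with | h z => ?_
  refine (hallNumberQ_cls x 0 z).trans ?_
  by_cases e : Nonempty (z ≅ x)
  · rw [show (Quotient.mk _ z : IsoClass T) = Quotient.mk _ x from cls_eq_iff.2 e,
      Finsupp.single_eq_same]
    exact hallNumber_zero_right_of_iso e.some
  · exact (hallNumber_zero_right_of_not e).trans
      (Finsupp.single_eq_of_ne fun h => e (cls_eq_iff.1 h)).symm

end Units

section Multiplication

variable [∀ x y : T, Finite (x ⟶ y)]

/-- The product of two basis elements of the derived Hall algebra. -/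
noncomputable def basisMul (a b : IsoClass T) : DH T :=
  Finsupp.ofSupportFinite (fun c => hallNumberQ T a b c) (finite_support_hallNumberQ a b)

lemma basisMul_apply (a b c : IsoClass T) : basisMul a b c = hallNumberQ T a b c := rfl

/-- The multiplication of the derived Hall algebra. -/
noncomputable def hallMul : DH T →ₗ[ℚ] DH T →ₗ[ℚ] DH T :=
  Finsupp.linearCombination ℚ fun a => Finsupp.linearCombination ℚ fun b => basisMul a b

lemma hallMul_single_single (a b : IsoClass T) :
    hallMul (Finsupp.single a 1) (Finsupp.single b 1) = basisMul a b := by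
  simp [hallMul]

lemma basisMul_eq_finsum (a b : IsoClass T) :
    basisMul a b = ∑ᶠ c : IsoClass T, hallNumberQ T a b c • Finsupp.single c (1 : ℚ) := by
  rw [finsum_eq_sum_of_support_subset (s := (basisMul a b).support)]
  · conv_lhs => rw [← Finsupp.sum_single (basisMul a b), Finsupp.sum]
    refine Finset.sum_congr rfl fun c _ => ?_
    simp [basisMul_apply]
  · intro c hc
    rw [Finset.mem_coe, Finsupp.mem_support_iff, basisMul_apply]
    exact fun h => hc (by simp [h])

lemma hallMul_left_apply (v : DH T) (c m : IsoClass T) :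
    hallMul v (Finsupp.single c 1) m = ∑ᶠ e, v e * hallNumberQ T e c m := by
  rw [finsum_eq_sum_of_support_subset (s := v.support)]
  · simp [hallMul, Finsupp.linearCombination_apply, Finsupp.sum, basisMul_apply,
      LinearMap.sum_apply]
  · intro e he
    rw [Finset.mem_coe, Finsupp.mem_support_iff]
    exact fun h => he (by simp [h])

lemma hallMul_right_apply (v : DH T) (a m : IsoClass T) :
    hallMul (Finsupp.single a 1) v m = ∑ᶠ e, v e * hallNumberQ T a e m := by
  rw [finsum_eq_sum_of_support_subset (s := v.support)]
  · simp [hallMul, Finsupp.linearCombination_apply, Finsupp.sum, basisMul_apply]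
  · intro e he
    rw [Finset.mem_coe, Finsupp.mem_support_iff]
    exact fun h => he (by simp [h])

lemma hallMul_assoc_single (hfin : Finitary T) (a b c : IsoClass T) :
    hallMul (basisMul a b) (Finsupp.single c 1) = hallMul (Finsupp.single a 1) (basisMul b c) := by
  ext m
  rw [hallMul_left_apply, hallMul_right_apply]
  exact finsum_hallNumber_assoc hfin a.out b.out c.out m.out

lemma hallMul_assoc (hfin : Finitary T) (u v w : DH T) :
    hallMul (hallMul u v) w = hallMul u (hallMul v w) := by
  induction u using Finsupp.induction_linear with
  | zero => simp
  | add u u' hu hu' => simp only [map_add, LinearMap.add_apply, hu, hu']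
  | single a r =>
  induction v using Finsupp.induction_linear with
  | zero => simp
  | add v v' hv hv' => simp only [map_add, LinearMap.add_apply, hv, hv']
  | single b s =>
  induction w using Finsupp.induction_linear with
  | zero => simp
  | add w w' hw hw' => simp only [map_add, hw, hw']
  | single c t =>
  rw [← mul_one r, ← mul_one s, ← mul_one t, ← smul_eq_mul, ← smul_eq_mul, ← smul_eq_mul,
    ← Finsupp.smul_single, ← Finsupp.smul_single, ← Finsupp.smul_single]
  simp only [map_smul, LinearMap.smul_apply, hallMul_single_single, hallMul_assoc_single hfin]

open ZeroObject in
lemma hallMul_zero_left (u : DH T) : hallMul (chi T 0) u = u := by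
  have h : hallMul (chi T 0) = LinearMap.id := by
    refine Finsupp.lhom_ext' fun a => LinearMap.ext_ring ?_
    ext c
    simp only [LinearMap.comp_apply, Finsupp.lsingle_apply, LinearMap.id_apply]
    rw [chi, hallMul_single_single, basisMul_apply, hallNumberQ_zero_left]
  rw [h, LinearMap.id_apply]

open ZeroObject in
lemma hallMul_zero_right (u : DH T) : hallMul u (chi T 0) = u := by
  have h : hallMul.flip (chi T 0) = LinearMap.id := by
    refine Finsupp.lhom_ext' fun a => LinearMap.ext_ring ?_
    ext c
    simp only [LinearMap.comp_apply, Finsupp.lsingle_apply, LinearMap.id_apply,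
      LinearMap.flip_apply]
    rw [chi, hallMul_single_single, basisMul_apply, hallNumberQ_zero_right]
  exact LinearMap.congr_fun h u

end Multiplication

variable (T)

open ZeroObject in
/-- The derived Hall multiplication is well defined (the derived Hall number depends only on
the isomorphism classes of its arguments, and for fixed `x, y` it is nonzero for only finitely
many classes `[z]`), and it makes `DH T` a unital associative `ℚ`-algebra, the bilinear
multiplication being determined by `χ_[x] ⬝ χ_[y] = ∑_{[z]} g^z_{x,y} χ_[z]`, with unit `χ_[0]`. -/
theorem derivedHallAlgebra_wellDefined_unital_associative
    [∀ x y : T, Finite (x ⟶ y)] (hfin : Finitary T) :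
    (∀ x y z : T, hallNumberQ T (cls T x) (cls T y) (cls T z) = hallNumber T x y z) ∧
    (∀ a b : IsoClass T, (Function.support fun c => hallNumberQ T a b c).Finite) ∧
    ∃ μ : DH T →ₗ[ℚ] DH T →ₗ[ℚ] DH T,
      (∀ x y : T, μ (chi T x) (chi T y) =
        ∑ᶠ c : IsoClass T, hallNumberQ T (cls T x) (cls T y) c • Finsupp.single c (1 : ℚ)) ∧
      (∀ a b c : DH T, μ (μ a b) c = μ a (μ b c)) ∧
      (∀ a : DH T, μ (chi T 0) a = a ∧ μ a (chi T 0) = a) := by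
  refine ⟨hallNumberQ_cls, finite_support_hallNumberQ, hallMul, fun x y => ?_,
    hallMul_assoc hfin, fun a => ⟨hallMul_zero_left a, hallMul_zero_right a⟩⟩
  rw [chi, chi, hallMul_single_single, basisMul_eq_finsum]

end DerivedHall
end

section
/- Let T be a finitary pretriangulated category over finite hom-sets with zero object 0. Then for all objects x, y, t of T: g^t_{0,y} = 1 if t is isomorphic to y and g^t_{0,y} = 0 otherwise; and g^t_{x,0} = 1 if t is isomorphic to x and g^t_{x,0} = 0 otherwise. In other words, the characteristic function of the zero object is a two-sided unit for the derived Hall multiplication. -/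
open CategoryTheory CategoryTheory.Limits CategoryTheory.Pretriangulated

namespace DerivedHall

variable (T : Type*) [Category T] [HasZeroObject T] [HasShift T ℤ]
  [Preadditive T] [∀ n : ℤ, (CategoryTheory.shiftFunctor T n).Additive] [Pretriangulated T]

variable {T}

lemma zero_mem_hallSet_iff {x z y : T} (hx : IsZero x) :
    (0 : x ⟶ z) ∈ hallSet T x z y ↔ Nonempty (z ≅ y) := by
  constructor
  · rintro ⟨y', g, h, hT, ⟨e⟩⟩
    have : IsIso g := (Triangle.isZero₁_iff_isIso₂ _ hT).1 hx
    exact ⟨asIso g ≪≫ e⟩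
  · rintro ⟨e⟩
    refine ⟨z, 𝟙 z, 0, ?_, ⟨e⟩⟩
    refine isomorphic_distinguished _ (contractible_distinguished₁ z) _ ?_
    exact Triangle.isoMk _ _ hx.isoZero (Iso.refl z) (Iso.refl z) (hx.eq_of_src _ _) rfl
      (zero_comp.trans comp_zero.symm)

lemma mem_hallSet_iff_isIso {x z y : T} (hy : IsZero y) (f : x ⟶ z) :
    f ∈ hallSet T x z y ↔ IsIso f := by
  constructor
  · rintro ⟨y', g, h, hT, ⟨e⟩⟩
    exact (Triangle.isZero₃_iff_isIso₁ _ hT).1 (hy.of_iso e)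
  · intro hf
    obtain ⟨y', g, h, hT⟩ := distinguished_cocone_triangle f
    exact ⟨y', g, h, hT, ⟨((Triangle.isZero₃_iff_isIso₁ _ hT).2 hf).iso hy⟩⟩

omit [HasZeroObject T] [Preadditive T] [∀ n : ℤ, (CategoryTheory.shiftFunctor T n).Additive]
  [Pretriangulated T] in
lemma extAltProd_eq_one_of_isZero {x : T} (hx : IsZero x) (y : T) : extAltProd T x y = 1 := by
  refine finprod_eq_one_of_forall_eq_one fun i => ?_
  have : Unique (x ⟶ y⟦(-(i : ℤ) - 1)⟧) := (hx.unique_to _).some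
  simp

omit [HasZeroObject T] [Preadditive T] [∀ n : ℤ, (CategoryTheory.shiftFunctor T n).Additive]
  [Pretriangulated T] in
lemma extAltProd_congr_right (x : T) {y z : T} (e : y ≅ z) :
    extAltProd T x y = extAltProd T x z := by
  refine finprod_congr fun i => ?_
  rw [Nat.card_congr ((shiftFunctor T (-(i : ℤ) - 1)).mapIso e).homToEquiv]

omit [HasZeroObject T] [∀ n : ℤ, (CategoryTheory.shiftFunctor T n).Additive] [Pretriangulated T] in
lemma extAltProd_pos [∀ x y : T, Finite (x ⟶ y)] (x y : T) : 0 < extAltProd T x y :=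
  finprod_induction (fun q : ℚ => 0 < q) one_pos (fun _ _ => mul_pos)
    fun i =>
      have : Nonempty (x ⟶ y⟦(-(i : ℤ) - 1)⟧) := ⟨0⟩
      zpow_pos (Nat.cast_pos.2 Nat.card_pos) _

lemma card_hallSet_of_isZero {x y z : T} (hy : IsZero y) (e : z ≅ x) :
    Nat.card (hallSet T x z y) = Nat.card (Aut x) :=
  Nat.card_congr
    { toFun f :=
        haveI := (mem_hallSet_iff_isIso hy f.1).1 f.2
        asIso f.1 ≪≫ e
      invFun a := ⟨(Iso.trans a e.symm).hom, (mem_hallSet_iff_isIso hy _).2 inferInstance⟩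
      left_inv f := by ext; simp
      right_inv a := Iso.ext <| (Category.assoc _ _ _).trans <|
        (congrArg _ e.inv_hom_id).trans (Category.comp_id _) }

variable (T)

open ZeroObject in
/-- The characteristic function of the zero object is a two-sided unit for the derived Hall
multiplication: `g^t_{0,y} = 1` if `t ≅ y` and `0` otherwise, and `g^t_{x,0} = 1` if `t ≅ x`
and `0` otherwise. -/
theorem hallNumber_zero_unit [∀ x y : T, Finite (x ⟶ y)] (hfin : Finitary T) (x y t : T) :
    ((Nonempty (t ≅ y) → hallNumber T 0 y t = 1) ∧
      (¬ Nonempty (t ≅ y) → hallNumber T 0 y t = 0)) ∧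
    ((Nonempty (t ≅ x) → hallNumber T x 0 t = 1) ∧
      (¬ Nonempty (t ≅ x) → hallNumber T x 0 t = 0)) := by
  refine ⟨⟨fun h => ?_, fun h => ?_⟩, ⟨fun ⟨e⟩ => ?_, fun h => ?_⟩⟩
  · have : Unique (hallSet T 0 t y) :=
      { default := ⟨0, (zero_mem_hallSet_iff (isZero_zero T)).2 h⟩
        uniq := fun _ => Subtype.ext ((isZero_zero T).eq_of_src _ _) }
    have : Unique (Aut (0 : T)) :=
      { default := 1
        uniq := fun _ => Iso.ext ((isZero_zero T).eq_of_src _ _) }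
    simp [hallNumber, extAltProd_eq_one_of_isZero (isZero_zero T)]
  · have : IsEmpty (hallSet T 0 t y) := ⟨fun f => h <| (zero_mem_hallSet_iff (isZero_zero T)).1 <|
      (isZero_zero T).eq_of_src f.1 0 ▸ f.2⟩
    simp [hallNumber]
  · have : Finite (Aut x) := Finite.of_injective (fun a : Aut x => a.hom) fun _ _ h => Iso.ext h
    rw [hallNumber, card_hallSet_of_isZero (isZero_zero T) e, extAltProd_congr_right x e]
    exact div_self (mul_pos (Nat.cast_pos.2 Nat.card_pos) (extAltProd_pos x x)).ne'
  · have : IsEmpty (hallSet T x t 0) := ⟨fun f => by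
      have := (mem_hallSet_iff_isIso (isZero_zero T) f.1).1 f.2
      exact h ⟨(asIso f.1).symm⟩⟩
    simp [hallNumber]

end DerivedHall
end

section
/- Let T be a finitary pretriangulated category over finite hom-sets and let x, y be objects of T. Then the set of isomorphism classes, in the arrow category of T, of morphisms f : x' → z' such that x' is isomorphic to x and there exists a distinguished triangle x' →f z' → y' → x'⟦1⟧ with y' isomorphic to y, is finite. (Two morphisms f : x' → z' and f'' : x'' → z'' are isomorphic in the arrow category if there are isomorphisms σ : x' → x'' and τ : z' → z'' with τ ∘ f = f'' ∘ σ.) -/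
open CategoryTheory CategoryTheory.Limits CategoryTheory.Pretriangulated

namespace DerivedHall

variable (T : Type*) [Category T] [HasZeroObject T] [HasShift T ℤ]
  [Preadditive T] [∀ n : ℤ, (CategoryTheory.shiftFunctor T n).Additive] [Pretriangulated T]

/-- The isomorphism class of a morphism `f : x' ⟶ z'` in the arrow category of `T`;
two morphisms are identified exactly when there are isomorphisms `σ : x' ≅ x''` and
`τ : z' ≅ z''` making the evident square commute. -/
def arrowCls {x' z' : T} (f : x' ⟶ z') : Quotient (isIsomorphicSetoid (Arrow T)) :=
  Quotient.mk (isIsomorphicSetoid (Arrow T)) (Arrow.mk f)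

variable {T} in
/-- Isomorphisms of the outer terms of two distinguished triangles which are compatible with the
connecting morphisms identify the isomorphism classes of their first morphisms. -/
theorem arrowCls_eq_of_distTriang {x x' z z' y y' : T} {f : x ⟶ z} {g : z ⟶ y} {h : y ⟶ x⟦(1 : ℤ)⟧}
    {f' : x' ⟶ z'} {g' : z' ⟶ y'} {h' : y' ⟶ x'⟦(1 : ℤ)⟧}
    (H : Triangle.mk f g h ∈ distTriang T) (H' : Triangle.mk f' g' h' ∈ distTriang T)
    (a : x ≅ x') (c : y ≅ y') (comm : h ≫ a.hom⟦(1 : ℤ)⟧' = c.hom ≫ h') :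
    arrowCls T f = arrowCls T f' := by
  obtain ⟨b, hb₁, hb₂⟩ : ∃ b : z ⟶ z', f ≫ b = a.hom ≫ f' ∧ g ≫ c.hom = b ≫ g' :=
    complete_distinguished_triangle_morphism₂ _ _ H H' a.hom c.hom comm
  let φ : Triangle.mk f g h ⟶ Triangle.mk f' g' h' :=
    { hom₁ := a.hom
      hom₂ := b
      hom₃ := c.hom
      comm₁ := hb₁
      comm₂ := hb₂
      comm₃ := comm }
  have : IsIso b := isIso₂_of_isIso₁₃ φ H H' (inferInstanceAs (IsIso a.hom))
    (inferInstanceAs (IsIso c.hom))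
  exact Quotient.sound ⟨Arrow.isoMk a (asIso b) hb₁.symm⟩

/-- In a finitary pretriangulated category with finite hom-sets, the set of isomorphism
classes, in the arrow category, of morphisms `f : x' ⟶ z'` with `x' ≅ x` admitting a
distinguished triangle `x' ⟶ z' ⟶ y' ⟶ x'⟦1⟧` with `y' ≅ y`, is finite. -/
theorem finite_arrow_isoClasses [∀ x y : T, Finite (x ⟶ y)] (hfin : Finitary T) (x y : T) :
    {c : Quotient (isIsomorphicSetoid (Arrow T)) |
      ∃ (x' z' : T) (f : x' ⟶ z'), Nonempty (x' ≅ x) ∧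
        (∃ (y' : T) (g : z' ⟶ y') (h : y' ⟶ x'⟦(1 : ℤ)⟧),
          (Triangle.mk f g h ∈ distTriang T) ∧ Nonempty (y' ≅ y)) ∧
        arrowCls T f = c}.Finite := by
  choose Z f₀ g₀ H₀ using fun w : y ⟶ x⟦(1 : ℤ)⟧ => distinguished_cocone_triangle₂ w
  refine (Set.finite_range fun w => arrowCls T (f₀ w)).subset ?_
  rintro _ ⟨x', z', f, ⟨a⟩, ⟨y', g, h, H, ⟨c⟩⟩, rfl⟩
  exact ⟨c.inv ≫ h ≫ a.hom⟦(1 : ℤ)⟧',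
    (arrowCls_eq_of_distTriang H (H₀ _) a c (by simp)).symm⟩

end DerivedHall
end

section
/- Let T be a pretriangulated category, let x →u z →p c →δ x⟦1⟧ be a distinguished triangle in T, and let g : w → c be any morphism. Then there exist an object y of T and morphisms a : x → y, b : y → w, and m : y → z such that x →a y →b w →(δ∘g) x⟦1⟧ is a distinguished triangle, m ∘ a = u, and p ∘ m = g ∘ b. -/
open CategoryTheory CategoryTheory.Limits CategoryTheory.Pretriangulated

namespace DerivedHall

variable (T : Type*) [Category T] [HasZeroObject T] [HasShift T ℤ]
  [Preadditive T] [∀ n : ℤ, (CategoryTheory.shiftFunctor T n).Additive] [Pretriangulated T]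

/-- Given a distinguished triangle `x ⟶u z ⟶p c ⟶δ x⟦1⟧` and any morphism `g : w ⟶ c`,
there are an object `y` and morphisms `a : x ⟶ y`, `b : y ⟶ w`, `m : y ⟶ z` such that
`x ⟶a y ⟶b w ⟶(δ ∘ g) x⟦1⟧` is a distinguished triangle, `m ∘ a = u` and `p ∘ m = g ∘ b`. -/
theorem exists_base_change (x z c w : T) (u : x ⟶ z) (p : z ⟶ c) (δ : c ⟶ x⟦(1 : ℤ)⟧)
    (hT : Triangle.mk u p δ ∈ distTriang T) (g : w ⟶ c) :
    ∃ (y : T) (a : x ⟶ y) (b : y ⟶ w) (m : y ⟶ z),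
      (Triangle.mk a b (g ≫ δ) ∈ distTriang T) ∧ a ≫ m = u ∧ m ≫ p = b ≫ g := by
  obtain ⟨y, a, b, hy⟩ := distinguished_cocone_triangle₂ (g ≫ δ)
  obtain ⟨m, ham, hbm⟩ :=
    complete_distinguished_triangle_morphism₂ _ _ hy hT (𝟙 x) g
      ((congrArg ((g ≫ δ) ≫ ·) ((shiftFunctor T (1 : ℤ)).map_id x)).trans
        (Category.comp_id (g ≫ δ)))
  exact ⟨y, a, b, m, hy, ham.trans (Category.id_comp u), hbm.symm⟩

end DerivedHall
end
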